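/- arXiv:2412.05678 — 13 statements merged into one kernel-verified Lean document; each statement's English description precedes it below -/
import Mathlib

section
/- Let K be a field of characteristic zero and let P0, P1, P2, P3, P4, P5 be nonzero vectors in K^3 representing six points of the projective plane, no three of which are collinear (i.e., det(Pi,Pj,Pk) ≠ 0 for all distinct i,j,k). Define the intersection points m1 = det(P0,P2,P3)•P5 − det(P5,P2,P3)•P0 (the meet of lines P0P5 and P2P3), m2 = det(P0,P3,P4)•P1 − det(P1,P3,P4)•P0 (the meet of lines P0P1 and P3P4), and m3 = det(P4,P1,P2)•P5 − det(P5,P1,P2)•P4 (the meet of lines P4P5 and P1P2). Then there exists a nonzero homogeneous polynomial of degree 2 in 3 variables over K vanishing at all six points if and only if det(m1,m2,m3) = 0. -/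
open MvPolynomial in
/-- On vectors, a ternary form of degree two is given by its six coefficients. -/
lemma MvPolynomial.IsHomogeneous.exists_eval_eq_ternary_quadratic {K : Type*} [CommRing K]
    {f : MvPolynomial (Fin 3) K} (hf : f.IsHomogeneous 2) :
    ∃ c : Fin 6 → K, ∀ x : Fin 3 → K, eval x f =
      c 0 * x 0 ^ 2 + c 1 * x 1 ^ 2 + c 2 * x 2 ^ 2 +
        c 3 * (x 0 * x 1) + c 4 * (x 0 * x 2) + c 5 * (x 1 * x 2) := by
  rw [f.as_sum]
  refine Finset.sum_induction _ (fun g ↦ ∃ c : Fin 6 → K, ∀ x : Fin 3 → K, eval x g =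
      c 0 * x 0 ^ 2 + c 1 * x 1 ^ 2 + c 2 * x 2 ^ 2 +
        c 3 * (x 0 * x 1) + c 4 * (x 0 * x 2) + c 5 * (x 1 * x 2)) ?_ ⟨0, by simp⟩ ?_
  · rintro g h ⟨c, hc⟩ ⟨d, hd⟩
    exact ⟨c + d, fun x ↦ by simp only [map_add, hc, hd, Pi.add_apply]; ring⟩
  · intro d hd
    have hdeg : d 0 + d 1 + d 2 = 2 := by
      have h := hf (mem_support_iff.mp hd)
      rwa [Finsupp.weight_apply, Finsupp.sum_fintype _ _ (by simp), Fin.sum_univ_three,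
        Pi.one_apply, Pi.one_apply, Pi.one_apply, smul_eq_mul, smul_eq_mul, smul_eq_mul,
        mul_one, mul_one, mul_one] at h
    generalize coeff d f = a
    have hcases : (d 0 = 2 ∧ d 1 = 0 ∧ d 2 = 0) ∨ (d 0 = 0 ∧ d 1 = 2 ∧ d 2 = 0) ∨
        (d 0 = 0 ∧ d 1 = 0 ∧ d 2 = 2) ∨ (d 0 = 1 ∧ d 1 = 1 ∧ d 2 = 0) ∨
        (d 0 = 1 ∧ d 1 = 0 ∧ d 2 = 1) ∨ (d 0 = 0 ∧ d 1 = 1 ∧ d 2 = 1) := by omega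
    have heval (x : Fin 3 → K) :
        eval x (monomial d a) = a * (x 0 ^ d 0 * x 1 ^ d 1 * x 2 ^ d 2) := by
      rw [eval_monomial, Finsupp.prod_fintype _ _ (by simp), Fin.prod_univ_three]
    simp only [heval]
    rcases hcases with ⟨h₀, h₁, h₂⟩ | ⟨h₀, h₁, h₂⟩ | ⟨h₀, h₁, h₂⟩ | ⟨h₀, h₁, h₂⟩ |
      ⟨h₀, h₁, h₂⟩ | ⟨h₀, h₁, h₂⟩ <;> simp only [h₀, h₁, h₂]
    · exact ⟨![a, 0, 0, 0, 0, 0], fun x ↦ by simp⟩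
    · exact ⟨![0, a, 0, 0, 0, 0], fun x ↦ by simp⟩
    · exact ⟨![0, 0, a, 0, 0, 0], fun x ↦ by simp⟩
    · exact ⟨![0, 0, 0, a, 0, 0], fun x ↦ by simp⟩
    · exact ⟨![0, 0, 0, 0, a, 0], fun x ↦ by simp⟩
    · exact ⟨![0, 0, 0, 0, 0, a], fun x ↦ by simp⟩

open Matrix in
lemma Matrix.det_of_vecMul {R : Type*} [CommRing R] (A : Matrix (Fin 3) (Fin 3) R)
    (a b c : Fin 3 → R) :
    (Matrix.of ![a ᵥ* A, b ᵥ* A, c ᵥ* A]).det = (Matrix.of ![a, b, c]).det * A.det := by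
  rw [← Matrix.det_mul]
  congr 1
  ext i j
  fin_cases i <;> rfl

/-- The products of pairs of coordinates, i.e. the monomials of the conics through the vertices
of the coordinate triangle. -/
def pairProducts {R : Type*} [Mul R] (x : Fin 3 → R) : Fin 3 → R :=
  ![x 0 * x 1, x 0 * x 2, x 1 * x 2]

open MvPolynomial Matrix in
/-- The conics through the three points represented by the rows of an invertible matrix `A`. -/
lemma exists_conic_iff_det_pairProducts {K : Type*} [Field K] [Infinite K]
    (A : Matrix (Fin 3) (Fin 3) K) (hA : IsUnit A.det) (q : Fin 3 → Fin 3 → K) :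
    (∃ f : MvPolynomial (Fin 3) K, f ≠ 0 ∧ f.IsHomogeneous 2 ∧
      (∀ i, eval (A i) f = 0) ∧ ∀ i, eval (q i ᵥ* A) f = 0) ↔
    (Matrix.of fun i ↦ pairProducts (q i)).det = 0 := by
  rw [← Matrix.exists_mulVec_eq_zero_iff]
  constructor
  · rintro ⟨f, hf0, hf, hvert, hq⟩
    obtain ⟨c, hc⟩ := hf.exists_eval_eq_ternary_quadratic
    have hexp : ∃ v : Fin 3 → K, ∀ x, eval (x ᵥ* A) f = pairProducts x ⬝ᵥ v := by
      have h₀ := hvert 0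
      have h₁ := hvert 1
      have h₂ := hvert 2
      rw [hc] at h₀ h₁ h₂
      let B (i j : Fin 3) : K :=
        2 * c 0 * (A i 0 * A j 0) + 2 * c 1 * (A i 1 * A j 1) + 2 * c 2 * (A i 2 * A j 2) +
          c 3 * (A i 0 * A j 1 + A i 1 * A j 0) + c 4 * (A i 0 * A j 2 + A i 2 * A j 0) +
          c 5 * (A i 1 * A j 2 + A i 2 * A j 1)
      refine ⟨![B 0 1, B 0 2, B 1 2], fun x ↦ ?_⟩
      rw [hc]
      simp only [pairProducts, B, Matrix.vecMul, dotProduct, Fin.sum_univ_three,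
        Matrix.cons_val]
      linear_combination x 0 ^ 2 * h₀ + x 1 ^ 2 * h₁ + x 2 ^ 2 * h₂
    obtain ⟨v, hv⟩ := hexp
    have hker (i : Fin 3) : pairProducts (q i) ⬝ᵥ v = 0 := by rw [← hv, hq]
    refine ⟨v, ?_, funext hker⟩
    rintro rfl
    refine hf0 (MvPolynomial.funext fun y ↦ ?_)
    have h := hv (y ᵥ* A⁻¹)
    rw [Matrix.vecMul_vecMul, Matrix.nonsing_inv_mul _ hA, Matrix.vecMul_one] at h
    simpa using h
  · rintro ⟨v, hv0, hv⟩
    let l (j : Fin 3) : MvPolynomial (Fin 3) K := ∑ i, C (A⁻¹ i j) * X i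
    have hl (j : Fin 3) : (l j).IsHomogeneous 1 :=
      IsHomogeneous.sum _ _ _ fun i _ ↦ by
        simpa using (isHomogeneous_C (Fin 3) (A⁻¹ i j)).mul (isHomogeneous_X K i)
    have hl_eval (x : Fin 3 → K) (j : Fin 3) : eval (x ᵥ* A) (l j) = x j := by
      have h : eval (x ᵥ* A) (l j) = ((x ᵥ* A) ᵥ* A⁻¹) j := by
        simp only [l, map_sum, map_mul, eval_C, eval_X]
        exact Finset.sum_congr rfl fun i _ ↦ mul_comm _ _
      rw [h, Matrix.vecMul_vecMul, Matrix.mul_nonsing_inv _ hA, Matrix.vecMul_one]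
    let f := C (v 0) * (l 0 * l 1) + C (v 1) * (l 0 * l 2) + C (v 2) * (l 1 * l 2)
    have hf_eval (x : Fin 3 → K) : eval (x ᵥ* A) f = pairProducts x ⬝ᵥ v := by
      simp only [f, map_add, map_mul, eval_C, hl_eval, pairProducts, dotProduct,
        Fin.sum_univ_three, Matrix.cons_val]
      ring
    have hterm (a : K) (i j : Fin 3) : (C a * (l i * l j)).IsHomogeneous 2 := by
      simpa using (isHomogeneous_C (Fin 3) a).mul ((hl i).mul (hl j))
    refine ⟨f, fun hf0 ↦ hv0 ?_, ((hterm _ _ _).add (hterm _ _ _)).add (hterm _ _ _),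
      fun i ↦ ?_, fun i ↦ (hf_eval (q i)).trans (congrFun hv i)⟩
    · have h (x : Fin 3 → K) : pairProducts x ⬝ᵥ v = 0 := by rw [← hf_eval, hf0, map_zero]
      have h₀ := h ![1, 1, 0]
      have h₁ := h ![1, 0, 1]
      have h₂ := h ![0, 1, 1]
      simp [pairProducts, dotProduct, Fin.sum_univ_three] at h₀ h₁ h₂
      ext i
      fin_cases i <;> assumption
    · have h : A i = Pi.single i 1 ᵥ* A := (Matrix.single_one_vecMul i A).symm
      rw [h, hf_eval]
      fin_cases i <;> simp [pairProducts, dotProduct, Fin.sum_univ_three]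

/-- Determinant of the three meets of opposite sides of the hexagon
`e₀, a, e₁, b, e₂, c`, where `e` is the standard basis. -/
lemma det_meets_eq_det_pairProducts {R : Type*} [CommRing R] (a b c : Fin 3 → R) :
    (Matrix.of
      ![(Matrix.of ![![1, 0, 0], ![0, 1, 0], b]).det • c -
          (Matrix.of ![c, ![0, 1, 0], b]).det • ![1, 0, 0],
        (Matrix.of ![![1, 0, 0], b, ![0, 0, 1]]).det • a -
          (Matrix.of ![a, b, ![0, 0, 1]]).det • ![1, 0, 0],
        (Matrix.of ![![0, 0, 1], a, ![0, 1, 0]]).det • c -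
          (Matrix.of ![c, a, ![0, 1, 0]]).det • ![0, 0, 1]]).det =
      (Matrix.of fun i ↦ pairProducts (![a, b, c] i)).det := by
  simp only [Matrix.det_fin_three, pairProducts, Matrix.of_apply, Matrix.cons_val,
    Pi.sub_apply, Pi.smul_apply, smul_eq_mul]
  ring


/-- Pascal / Braikenridge–Maclaurin: six points in the projective plane lie
on a conic iff the three constructed intersection points are collinear. -/
theorem pascal_braikenridge_maclaurin {K : Type*} [Field K] [CharZero K]
    (P : Fin 6 → Fin 3 → K) (hP : ∀ i, P i ≠ 0)
    (hgen : ∀ i j k : Fin 6, i ≠ j → i ≠ k → j ≠ k →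
      (Matrix.of ![P i, P j, P k]).det ≠ 0) :
    (∃ f : MvPolynomial (Fin 3) K, f ≠ 0 ∧ f.IsHomogeneous 2 ∧
      ∀ i, MvPolynomial.eval (P i) f = 0) ↔
    (Matrix.of
      ![(Matrix.of ![P 0, P 2, P 3]).det • P 5 - (Matrix.of ![P 5, P 2, P 3]).det • P 0,
        (Matrix.of ![P 0, P 3, P 4]).det • P 1 - (Matrix.of ![P 1, P 3, P 4]).det • P 0,
        (Matrix.of ![P 4, P 1, P 2]).det • P 5 - (Matrix.of ![P 5, P 1, P 2]).det • P 4]).det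
      = 0 := by
  have hA : IsUnit (Matrix.of ![P 0, P 2, P 4]).det :=
    isUnit_iff_ne_zero.mpr (hgen 0 2 4 (by decide) (by decide) (by decide))
  set A : Matrix (Fin 3) (Fin 3) K := Matrix.of ![P 0, P 2, P 4]
  have hrow (x : Fin 3 → K) : ∃ y, x = Matrix.vecMul y A :=
    ⟨Matrix.vecMul x A⁻¹, by
      rw [Matrix.vecMul_vecMul, Matrix.nonsing_inv_mul _ hA, Matrix.vecMul_one]⟩
  obtain ⟨a, ha⟩ := hrow (P 1)
  obtain ⟨b, hb⟩ := hrow (P 3)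
  obtain ⟨c, hc⟩ := hrow (P 5)
  have h₀ : P 0 = Matrix.vecMul ![1, 0, 0] A := by
    ext j; simp [A, Matrix.vecMul, dotProduct, Fin.sum_univ_three]
  have h₂ : P 2 = Matrix.vecMul ![0, 1, 0] A := by
    ext j; simp [A, Matrix.vecMul, dotProduct, Fin.sum_univ_three]
  have h₄ : P 4 = Matrix.vecMul ![0, 0, 1] A := by
    ext j; simp [A, Matrix.vecMul, dotProduct, Fin.sum_univ_three]
  have hconic (f : MvPolynomial (Fin 3) K) : (∀ i, MvPolynomial.eval (P i) f = 0) ↔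
      (∀ i, MvPolynomial.eval (A i) f = 0) ∧
        ∀ i, MvPolynomial.eval (Matrix.vecMul (![a, b, c] i) A) f = 0 := by
    have hA₀ : A 0 = P 0 := rfl
    have hA₁ : A 1 = P 2 := rfl
    have hA₂ : A 2 = P 4 := rfl
    simp only [Fin.forall_fin_succ, IsEmpty.forall_iff, and_true]
    simp [hA₀, hA₁, hA₂, ← ha, ← hb, ← hc]
    tauto
  simp only [hconic]
  rw [exists_conic_iff_det_pairProducts A hA, ← det_meets_eq_det_pairProducts]
  clear_value A
  rw [h₀, h₂, h₄, ha, hb, hc]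
  simp only [Matrix.det_of_vecMul, ← Matrix.smul_vecMul, ← Matrix.sub_vecMul]
  simp only [mul_comm _ A.det, mul_smul, ← smul_sub]
  have hsmul (d : K) (x y z : Fin 3 → K) :
      (Matrix.of ![d • x, d • y, d • z]).det = d ^ 3 * (Matrix.of ![x, y, z]).det := by
    simp only [Matrix.det_fin_three, Matrix.of_apply, Matrix.cons_val, Pi.smul_apply,
      smul_eq_mul]
    ring
  rw [hsmul, mul_eq_zero_iff_left hA.ne_zero, mul_eq_zero_iff_left (pow_ne_zero 3 hA.ne_zero)]
end

section
/- Let K be a commutative ring and let v_0, v_1, v_2, v_3, v_4, v_5 be vectors in K^4. Define p = [v_0 v_1 v_2 v_5]•v_3 − [v_0 v_1 v_3 v_5]•v_2, q = −[v_0 v_1 v_2 v_4]•v_3 − [v_0 v_2 v_3 v_4]•v_1, and r = [v_1 v_3 v_4 v_5]•v_2 − [v_2 v_3 v_4 v_5]•v_1. Then −[v_1 v_0 v_2 q]·[v_0 p v_3 r] + [p v_0 v_2 q]·[v_0 v_1 v_3 r] = [v_0 v_1 v_2 v_3]^2 · ([v_0 v_1 v_2 v_5][v_0 v_2 v_3 v_4][v_1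 v_3 v_4 v_5] − [v_0 v_1 v_2 v_4][v_2 v_3 v_4 v_5][v_0 v_1 v_3 v_5]). -/
/-- The bracket `[a b c d]`: determinant of the 4×4 matrix with columns
(equivalently rows) `a`, `b`, `c`, `d`. -/
def br {K : Type*} [CommRing K] (a b c d : Fin 4 → K) : K :=
  (Matrix.of ![a, b, c, d]).det

section BracketLemmas

variable {K : Type*} [CommRing K] (a b c d : Fin 4 → K) (s t u v : K)

theorem br_swap_smul_sub_smul :
    br b a c (s • d - t • b) = -s * br a b c d := by
  simp [br, Matrix.det_succ_row_zero, Fin.sum_univ_succ, Fin.succAbove]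
  ring

theorem br_smul_sub_smul_right :
    br a b d (s • c - t • b) = -s * br a b c d := by
  simp [br, Matrix.det_succ_row_zero, Fin.sum_univ_succ, Fin.succAbove]
  ring

theorem br_smul_sub_smul_middle_last :
    br a (s • d - t • c) d (u • c - v • b) = t * v * br a b c d := by
  simp [br, Matrix.det_succ_row_zero, Fin.sum_univ_succ, Fin.succAbove]
  ring

theorem br_smul_sub_smul_first_last :
    br (s • d - t • c) a c (u • d - v • b) = -(s * v) * br a b c d := by
  simp [br, Matrix.det_succ_row_zero, Fin.sum_univ_succ, Fin.succAbove]
  ring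

end BracketLemmas

/-- The key identity in the proof of Lemma 3.1: with `p = 23 ∧ 015`,
`q = 13 ∧ 024`, `r = 12 ∧ 345`, the coincidence expression for the lines
`1p`, `2q`, `3r` equals `[0123]²·Q`. -/
theorem coincidence_identity {K : Type*} [CommRing K]
    (v0 v1 v2 v3 v4 v5 : Fin 4 → K)
    (p q r : Fin 4 → K)
    (hp : p = br v0 v1 v2 v5 • v3 - br v0 v1 v3 v5 • v2)
    (hq : q = -(br v0 v1 v2 v4) • v3 - br v0 v2 v3 v4 • v1)
    (hr : r = br v1 v3 v4 v5 • v2 - br v2 v3 v4 v5 • v1) :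
    -(br v1 v0 v2 q * br v0 p v3 r) + br p v0 v2 q * br v0 v1 v3 r =
      br v0 v1 v2 v3 ^ 2 *
        (br v0 v1 v2 v5 * br v0 v2 v3 v4 * br v1 v3 v4 v5 -
          br v0 v1 v2 v4 * br v2 v3 v4 v5 * br v0 v1 v3 v5) := by
  subst hp hq hr
  rw [br_swap_smul_sub_smul, br_smul_sub_smul_middle_last, br_smul_sub_smul_first_last,
    br_smul_sub_smul_right]
  ring
end

section
/- Let K be a field and let v_0, v_1, v_2, v_3, v_4, v_5 be vectors in K^4 with [v_0 v_1 v_2 v_3] ≠ 0, [v_0 v_1 v_4 v_5] ≠ 0, and [v_2 v_3 v_4 v_5] ≠ 0. Define p = [v_0 v_1 v_2 v_5]•v_3 − [v_0 v_1 v_3 v_5]•v_2, q = −[v_0 v_1 v_2 v_4]•v_3 − [v_0 v_2 v_3 v_4]•v_1, and r = [v_1 v_3 v_4 v_5]•v_2 − [v_2 v_3 v_4 v_5]•v_1, and assume that span{v_1, p}, span{v_2, q}, and span{v_3, r} are each 2-dimensional and pairwise distinct subspaces of K^4. Then there exists a nonzero vector lying in span{v_1, p} ∩ span{v_2, q} ∩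 span{v_3, r} if and only if [v_0 v_1 v_2 v_5][v_0 v_2 v_3 v_4][v_1 v_3 v_4 v_5] − [v_0 v_1 v_2 v_4][v_2 v_3 v_4 v_5][v_0 v_1 v_3 v_5] = 0. -/
lemma linearIndependent_of_br_ne_zero {K : Type*} [Field K] {a b c d : Fin 4 → K}
    (h : br a b c d ≠ 0) : LinearIndependent K ![b, c, d] := by
  have h4 : LinearIndependent K ![a, b, c, d] :=
    Matrix.linearIndependent_rows_of_det_ne_zero (A := Matrix.of ![a, b, c, d]) h
  exact (linearIndependent_finCons.1 h4).1

section Plane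

variable {K V : Type*} [Field K] [AddCommGroup V] [Module K V]

lemma eq_zero_of_triple_of_linearIndependent {u v w : V} (hli : LinearIndependent K ![u, v, w])
    {x y z : K} (h : x • u + y • v + z • w = 0) : x = 0 ∧ y = 0 ∧ z = 0 := by
  have h' := Fintype.linearIndependent_iff.1 hli ![x, y, z] (by simpa [Fin.sum_univ_three] using h)
  exact ⟨h' 0, h' 1, h' 2⟩

lemma coeff_ne_zero_of_finrank_span_pair {u v w : V} {a b : K}
    (h : Module.finrank K (Submodule.span K {u, a • w - b • v}) = 2) : a ≠ 0 ∨ b ≠ 0 := by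
  by_contra! hab
  have h1 := finrank_span_le_card (R := K) ({u} : Set V)
  rw [hab.1, hab.2, zero_smul, zero_smul, sub_zero, Set.pair_comm,
    Submodule.span_insert_zero] at h
  simp at h1
  omega

/-- In the basis `u, v, w` of a plane, the line through `u` and `a • w - b • v` is cut out by one
linear equation. -/
lemma mem_span_pair_iff_of_linearIndependent {u v w : V} (hli : LinearIndependent K ![u, v, w])
    {a b : K} (hab : a ≠ 0 ∨ b ≠ 0) (x y z : K) :
    x • u + y • v + z • w ∈ Submodule.span K {u, a • w - b • v} ↔ a * y + b * z = 0 := by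
  rw [Submodule.mem_span_pair]
  constructor
  · rintro ⟨s, t, h⟩
    have h0 : (s - x) • u + (-(t * b) - y) • v + (t * a - z) • w = 0 := by
      rw [← sub_eq_zero] at h
      rw [← h]
      module
    obtain ⟨-, hy, hz⟩ := eq_zero_of_triple_of_linearIndependent hli h0
    linear_combination -a * hy - b * hz
  · intro h
    obtain ha | hb := hab
    · refine ⟨x, z / a, ?_⟩
      have hy : y = -(z / a * b) := by field_simp; linear_combination h
      have hz : z = z / a * a := by field_simp
      rw [hy]
      nth_rw 3 [hz]
      module
    · refine ⟨x, -(y / b), ?_⟩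
      have hz : z = -(y / b * a) := by field_simp; linear_combination h
      have hy : y = y / b * b := by field_simp
      rw [hz]
      nth_rw 2 [hy]
      module

/-- Three lines of a plane, each through one vertex of the triangle `u, v, w` and a point of the
opposite side, meet exactly when the determinant of their equations vanishes. -/
lemma exists_mem_inf_span_pair_iff {u v w : V} (hli : LinearIndependent K ![u, v, w])
    {a b c d e f : K} (hab : a ≠ 0 ∨ b ≠ 0) (hcd : c ≠ 0 ∨ d ≠ 0) (hef : e ≠ 0 ∨ f ≠ 0) :
    (∃ x : V, x ≠ 0 ∧ x ∈ Submodule.span K {u, a • w - b • v} ⊓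
      Submodule.span K {v, c • w - d • u} ⊓ Submodule.span K {w, e • v - f • u}) ↔
      a * d * e + b * c * f = 0 := by
  have key (x y z : K) : (x • u + y • v + z • w ∈ Submodule.span K {u, a • w - b • v} ⊓
      Submodule.span K {v, c • w - d • u} ⊓ Submodule.span K {w, e • v - f • u}) ↔
      !![0, a, b; c, 0, d; e, f, 0].mulVec ![x, y, z] = 0 := by
    have hv : LinearIndependent K ![v, u, w] := by
      convert hli.comp ![1, 0, 2] (by decide) using 1
      ext i; fin_cases i <;> rfl
    have hw : LinearIndependent K ![w, u, v] := by
      convert hli.comp ![2, 0, 1] (by decide) using 1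
      ext i; fin_cases i <;> rfl
    have h1 := mem_span_pair_iff_of_linearIndependent hli hab x y z
    have h2 := mem_span_pair_iff_of_linearIndependent hv hcd y x z
    have h3 := mem_span_pair_iff_of_linearIndependent hw hef z x y
    rw [add_comm (y • v)] at h2
    rw [add_assoc, add_comm (z • w)] at h3
    simp only [Submodule.mem_inf, h1, h2, h3]
    simp [funext_iff, Fin.forall_fin_succ, and_assoc, mul_comm]
  have hdet : !![0, a, b; c, 0, d; e, f, 0].det = a * d * e + b * c * f := by
    simp [Matrix.det_fin_three]
  rw [← hdet, ← Matrix.exists_mulVec_eq_zero_iff]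
  constructor
  · rintro ⟨p, hp, hmem⟩
    obtain ⟨s, t, hst⟩ := Submodule.mem_span_pair.1 hmem.1.1
    have hp' : p = s • u + (-(t * b)) • v + (t * a) • w := by rw [← hst]; module
    refine ⟨![s, -(t * b), t * a], fun h0 => hp ?_, (key _ _ _).1 (hp' ▸ hmem)⟩
    have hs := congrFun h0 0
    have hb := congrFun h0 1
    have ha := congrFun h0 2
    simp only [Matrix.cons_val, Pi.zero_apply] at hs hb ha
    rw [hp', hs, hb, ha]
    simp
  · rintro ⟨y, hy, h⟩
    have hy' : y = ![y 0, y 1, y 2] := by ext i; fin_cases i <;> rfl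
    refine ⟨y 0 • u + y 1 • v + y 2 • w, fun h0 => hy ?_, (key _ _ _).2 (hy' ▸ h)⟩
    obtain ⟨h0, h1, h2⟩ := eq_zero_of_triple_of_linearIndependent hli h0
    rw [hy', h0, h1, h2]
    ext i; fin_cases i <;> rfl

end Plane

/-- Incidence characterization of the vanishing of `Q` (Lemma 3.1): the lines
`1p`, `2q`, `3r` meet in a common point precisely when the bracket binomial
vanishes. -/
theorem lines_coincident_iff_Q_eq_zero {K : Type*} [Field K]
    (v0 v1 v2 v3 v4 v5 : Fin 4 → K)
    (h0123 : br v0 v1 v2 v3 ≠ 0)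
    (h0145 : br v0 v1 v4 v5 ≠ 0)
    (h2345 : br v2 v3 v4 v5 ≠ 0)
    (p q r : Fin 4 → K)
    (hp : p = br v0 v1 v2 v5 • v3 - br v0 v1 v3 v5 • v2)
    (hq : q = -(br v0 v1 v2 v4) • v3 - br v0 v2 v3 v4 • v1)
    (hr : r = br v1 v3 v4 v5 • v2 - br v2 v3 v4 v5 • v1)
    (hd1 : Module.finrank K ↥(Submodule.span K {v1, p}) = 2)
    (hd2 : Module.finrank K ↥(Submodule.span K {v2, q}) = 2)
    (hd3 : Module.finrank K ↥(Submodule.span K {v3, r}) = 2)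
    (h12 : Submodule.span K {v1, p} ≠ Submodule.span K {v2, q})
    (h13 : Submodule.span K {v1, p} ≠ Submodule.span K {v3, r})
    (h23 : Submodule.span K {v2, q} ≠ Submodule.span K {v3, r}) :
    (∃ x : Fin 4 → K, x ≠ 0 ∧
        x ∈ Submodule.span K {v1, p} ⊓ Submodule.span K {v2, q} ⊓
          Submodule.span K {v3, r}) ↔
      br v0 v1 v2 v5 * br v0 v2 v3 v4 * br v1 v3 v4 v5 -
        br v0 v1 v2 v4 * br v2 v3 v4 v5 * br v0 v1 v3 v5 = 0 := by
  have hli := linearIndependent_of_br_ne_zero h0123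
  clear h0123 h0145 h2345
  generalize br v0 v1 v2 v5 = a, br v0 v1 v3 v5 = b, br v0 v1 v2 v4 = c, br v0 v2 v3 v4 = d,
    br v1 v3 v4 v5 = e, br v2 v3 v4 v5 = f at *
  subst hp hq hr
  rw [exists_mem_inf_span_pair_iff hli
    (coeff_ne_zero_of_finrank_span_pair hd1) (coeff_ne_zero_of_finrank_span_pair hd2)
    (coeff_ne_zero_of_finrank_span_pair hd3)]
  ring_nf
end

section
/- Let K be a field and let a, b, c, d, e, f, g be vectors in K^4. Define p = [a b c e]•d − [a b c d]•e. Then [e (d+e) f g]·[d p f g]·[a b c e] = −[a b c d]·[e p f g]·[d (d+e) f g]. (Equivalently, with d and e serving as the zero and infinity points and d+e as the unit point on the line spanned by d and e, the point p = de ∧ abc has local parameter −[a b c d]/[a b c e] on this line, the local parameter being computed as a cross ratio of determinants.) -/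
theorem br_smul_add_smul_right {K : Type*} [CommRing K] (s t : K) (d e f g : Fin 4 → K) :
    br d (s • d + t • e) f g = t * br d e f g := by
  simp [br, Matrix.det_succ_row_zero, Fin.sum_univ_succ, Fin.succAbove]
  ring

theorem br_swap_left {K : Type*} [CommRing K] (d e f g : Fin 4 → K) :
    br e d f g = -br d e f g := by
  simp [br, Matrix.det_succ_row_zero, Fin.sum_univ_succ, Fin.succAbove]
  ring

/-- Lemma 3.2, as a fraction-free determinant identity: the point
`p = de ∧ abc` has local parameter `−[abcd]/[abce]` on the line `de`
(with `d`, `e`, `d+e` serving as zero, infinity, and unit). -/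
theorem meet_local_parameter {K : Type*} [Field K] (a b c d e f g : Fin 4 → K) :
    br e (d + e) f g * br d (br a b c e • d - br a b c d • e) f g * br a b c e =
      -(br a b c d * br e (br a b c e • d - br a b c d • e) f g *
        br d (d + e) f g) := by
  have unit_d : br d (d + e) f g = br d e f g := by
    simpa using br_smul_add_smul_right 1 1 d e f g
  have unit_e : br e (d + e) f g = -br d e f g := by
    rw [add_comm, ← br_swap_left]
    simpa using br_smul_add_smul_right 1 1 e d f g
  have meet_d (s t : K) : br d (s • d - t • e) f g = -t * br d e f g := by
    rw [sub_eq_add_neg, ← neg_smul, br_smul_add_smul_right]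
  have meet_e (s t : K) : br e (s • d - t • e) f g = -s * br d e f g := by
    rw [sub_eq_add_neg, ← neg_smul, add_comm, br_smul_add_smul_right, br_swap_left]
    ring
  rw [unit_d, unit_e, meet_d, meet_e]
  ring
end

section
/- Let K be a commutative ring and let a, b, c, d, e, f be vectors in K^4. Then −[a b d e][a b c f][d e c f] − [a b c e][a b d f][c e d f] = [a b c d][a b e f][c d e f]. -/
theorem br_eq {K : Type*} [CommRing K] (a b c d : Fin 4 → K) :
    br a b c d =
      (a 0 * b 1 - a 1 * b 0) * (c 2 * d 3 - c 3 * d 2) -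
      (a 0 * b 2 - a 2 * b 0) * (c 1 * d 3 - c 3 * d 1) +
      (a 0 * b 3 - a 3 * b 0) * (c 1 * d 2 - c 2 * d 1) +
      (a 1 * b 2 - a 2 * b 1) * (c 0 * d 3 - c 3 * d 0) -
      (a 1 * b 3 - a 3 * b 1) * (c 0 * d 2 - c 2 * d 0) +
      (a 2 * b 3 - a 3 * b 2) * (c 0 * d 1 - c 1 * d 0) := by
  simp [br, Matrix.det_succ_row_zero, Fin.sum_univ_succ, Fin.succAbove]
  ring

theorem br_swap_middle {K : Type*} [CommRing K] (a b c d : Fin 4 → K) :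
    br a c b d = -br a b c d := by
  rw [br_eq, br_eq]
  ring

theorem br_rotate_left {K : Type*} [CommRing K] (a b c d : Fin 4 → K) :
    br b c a d = br a b c d := by
  rw [br_eq, br_eq]
  ring

/-- The three-term Plücker relation for the brackets containing `a` and `b`. -/
theorem br_plucker {K : Type*} [CommRing K] (a b c d e f : Fin 4 → K) :
    br a b c d * br a b e f - br a b c e * br a b d f + br a b c f * br a b d e = 0 := by
  simp only [br_eq]
  ring

/-- The three-term bracket identity (a Grassmann–Plücker-type relation,
a consequence of Cramer's rule) from the proof of Lemma 5.3. -/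
theorem three_term_bracket_identity {K : Type*} [CommRing K]
    (a b c d e f : Fin 4 → K) :
    -(br a b d e * br a b c f * br d e c f) -
      br a b c e * br a b d f * br c e d f =
    br a b c d * br a b e f * br c d e f := by
  rw [br_rotate_left c d e f, br_swap_middle c d e f]
  linear_combination -br c d e f * br_plucker a b c d e f
end

section
/- Let K be a field and let W be a 3-dimensional subspace of K^4. Let p, q, r, s, t, u, i, j, k, ℓ be vectors in K^4 such that i, j, k, ℓ all lie in W, the pairs (p,q), (r,s), (t,u), (i,j), (k,ℓ) are each linearly independent, and [r s t u] ≠ 0. Assume: span{p,q} ∩ W is 1-dimensional and is not contained in span{i,j}; span{r,s} ∩ W is 1-dimensional and is not contained in span{k,ℓ}; and span{t,u} ∩ W is 1-dimensional and is not contained in span{k,ℓ}. Then [k ℓ r s] ≠ 0, [k ℓ t u] ≠ 0, and [p q i j] ≠ 0; that is, after swapping the labels of p,q with k,ℓ, the three lines kℓ, rs, tu are mutually skew and the four points i, j, p, q are in general position. -/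
theorem br_ne_zero_of_disjoint_span {K : Type*} [Field K] {a b c d : Fin 4 → K}
    (hab : LinearIndependent K ![a, b]) (hcd : LinearIndependent K ![c, d])
    (h : Disjoint (Submodule.span K {a, b}) (Submodule.span K {c, d})) :
    br a b c d ≠ 0 := by
  have hsum : LinearIndependent K (Sum.elim ![a, b] ![c, d]) :=
    hab.sum_type hcd (by
      simpa only [Matrix.range_cons, Matrix.range_empty, Set.union_empty, Set.singleton_union] using h)
  have hrows : LinearIndependent K (Matrix.of ![a, b, c, d]).row := by
    rw [← linearIndependent_equiv (finSumFinEquiv (m := 2) (n := 2))]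
    convert hsum using 1
    funext x
    rcases x with x | x <;> fin_cases x <;> rfl
  rw [Matrix.linearIndependent_rows_iff_isUnit, Matrix.isUnit_iff_isUnit_det] at hrows
  exact hrows.ne_zero

theorem Submodule.disjoint_of_finrank_inf_eq_one {K V : Type*} [DivisionRing K] [AddCommGroup V]
    [Module K V] {S T W : Submodule K V} (hTW : T ≤ W)
    (h : Module.finrank K ↥(S ⊓ W) = 1) (h' : ¬ S ⊓ W ≤ T) : Disjoint S T := by
  have : FiniteDimensional K ↥(S ⊓ W) := Module.finite_of_finrank_eq_succ h
  have hle : S ⊓ T ≤ S ⊓ W := inf_le_inf_left S hTW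
  have hlt : S ⊓ T < S ⊓ W := hle.lt_of_ne fun he => h' (he ▸ inf_le_right)
  have : FiniteDimensional K ↥(S ⊓ T) := Submodule.finiteDimensional_of_le hle
  have hfin := Submodule.finrank_lt_finrank_of_lt hlt
  rw [disjoint_iff, ← Submodule.finrank_eq_zero (R := K)]
  omega

/-- The skew swap construction (Lemma 5.4): after swapping the labels of
`p,q` with `k,ℓ`, the three lines `kℓ`, `rs`, `tu` are mutually skew and the
four points `i`, `j`, `p`, `q` are in general position. -/
theorem skew_swap {K : Type*} [Field K]
    (W : Submodule K (Fin 4 → K)) (hW : Module.finrank K ↥W = 3)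
    (p q r s t u i j k l : Fin 4 → K)
    (hiW : i ∈ W) (hjW : j ∈ W) (hkW : k ∈ W) (hlW : l ∈ W)
    (hpq : LinearIndependent K ![p, q])
    (hrs : LinearIndependent K ![r, s])
    (htu : LinearIndependent K ![t, u])
    (hij : LinearIndependent K ![i, j])
    (hkl : LinearIndependent K ![k, l])
    (hrstu : br r s t u ≠ 0)
    (h1 : Module.finrank K ↥(Submodule.span K {p, q} ⊓ W) = 1)
    (h1' : ¬ (Submodule.span K {p, q} ⊓ W ≤ Submodule.span K {i, j}))
    (h2 : Module.finrank K ↥(Submodule.span K {r, s} ⊓ W) = 1)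
    (h2' : ¬ (Submodule.span K {r, s} ⊓ W ≤ Submodule.span K {k, l}))
    (h3 : Module.finrank K ↥(Submodule.span K {t, u} ⊓ W) = 1)
    (h3' : ¬ (Submodule.span K {t, u} ⊓ W ≤ Submodule.span K {k, l})) :
    br k l r s ≠ 0 ∧ br k l t u ≠ 0 ∧ br p q i j ≠ 0 := by
  have span_le {x y : Fin 4 → K} (hx : x ∈ W) (hy : y ∈ W) : Submodule.span K {x, y} ≤ W :=
    Submodule.span_le.2 (Set.pair_subset hx hy)
  exact ⟨br_ne_zero_of_disjoint_span hkl hrs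
      (Submodule.disjoint_of_finrank_inf_eq_one (span_le hkW hlW) h2 h2').symm,
    br_ne_zero_of_disjoint_span hkl htu
      (Submodule.disjoint_of_finrank_inf_eq_one (span_le hkW hlW) h3 h3').symm,
    br_ne_zero_of_disjoint_span hpq hij
      (Submodule.disjoint_of_finrank_inf_eq_one (span_le hiW hjW) h1 h1')⟩
end

section
/- Let K be a field, let f be a homogeneous polynomial of degree 2 in 4 variables over K, let W be a 3-dimensional subspace of K^4, and let L_1, L_2, L_3 be three pairwise distinct 2-dimensional subspaces of K^4 each contained in W. If f vanishes at every vector of L_1 ∪ L_2 ∪ L_3, then f vanishes at every vector of W. -/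
theorem MvPolynomial.IsHomogeneous.exists_bilinForm_eval_eq {σ R : Type*} [CommRing R]
    {f : MvPolynomial σ R} (hf : f.IsHomogeneous 2) :
    ∃ B : LinearMap.BilinForm R (σ → R), ∀ x, MvPolynomial.eval x f = B x x := by
  rw [← MvPolynomial.mem_homogeneousSubmodule, ← MvPolynomial.homogeneousSubmodule_one_pow,
    MvPolynomial.homogeneousSubmodule_one_eq_span_X, pow_two, Submodule.span_mul_span] at hf
  induction hf using Submodule.span_induction with
  | mem g hg =>
    obtain ⟨_, ⟨i, rfl⟩, _, ⟨j, rfl⟩, rfl⟩ := hg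
    exact ⟨LinearMap.BilinForm.linMulLin (LinearMap.proj i) (LinearMap.proj j), fun x => by simp⟩
  | zero => exact ⟨0, by simp⟩
  | add g h _ _ hg hh =>
    obtain ⟨B, hB⟩ := hg
    obtain ⟨C, hC⟩ := hh
    exact ⟨B + C, fun x => by simp [hB, hC]⟩
  | smul a g _ hg =>
    obtain ⟨B, hB⟩ := hg
    exact ⟨a • B, fun x => by simp [hB]⟩

namespace Submodule

variable {K V : Type*} [Field K] [AddCommGroup V] [Module K V]

theorem le_sup_span_singleton_of_finrank_le {S L : Submodule K V} [FiniteDimensional K L]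
    (hle : S ≤ L) (hrank : Module.finrank K L ≤ Module.finrank K S + 1) {p : V}
    (hpL : p ∈ L) (hpS : p ∉ S) : L ≤ S ⊔ K ∙ p := by
  have hsup : S ⊔ K ∙ p ≤ L := sup_le hle (by simpa using hpL)
  have : FiniteDimensional K ↥(S ⊔ K ∙ p) := finiteDimensional_of_le hsup
  have hlt : S < S ⊔ K ∙ p :=
    left_lt_sup.2 fun h => hpS (h (mem_span_singleton_self p))
  exact (eq_of_le_of_finrank_le hsup (hrank.trans (finrank_lt_finrank_of_lt hlt))).ge

theorem exists_mem_notMem_notMem {L M N : Submodule K V} (hM : ¬ L ≤ M) (hN : ¬ L ≤ N) :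
    ∃ u ∈ L, u ∉ M ∧ u ∉ N := by
  obtain ⟨a, haL, haM⟩ := SetLike.not_le_iff_exists.1 hM
  obtain ⟨b, hbL, hbN⟩ := SetLike.not_le_iff_exists.1 hN
  by_cases haN : a ∈ N
  · by_cases hbM : b ∈ M
    · exact ⟨a + b, L.add_mem haL hbL, fun h => haM ((M.add_mem_iff_left hbM).1 h),
        fun h => hbN ((N.add_mem_iff_right haN).1 h)⟩
    · exact ⟨b, hbL, hbM, hbN⟩
  · exact ⟨a, haL, haM, haN⟩

end Submodule

theorem LinearMap.BilinForm.apply_self_eq_zero_of_three_lines {K V : Type*} [Field K]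
    [AddCommGroup V] [Module K V] (B : LinearMap.BilinForm K V) {W L₁ L₂ L₃ : Submodule K V}
    (hW : Module.finrank K W = 3) (hL₁ : Module.finrank K L₁ = 2)
    (hL₂ : Module.finrank K L₂ = 2) (hL₃ : Module.finrank K L₃ = 2)
    (h12 : L₁ ≠ L₂) (h13 : L₁ ≠ L₃) (h23 : L₂ ≠ L₃)
    (hle₁ : L₁ ≤ W) (hle₂ : L₂ ≤ W) (hle₃ : L₃ ≤ W)
    (hB₁ : ∀ x ∈ L₁, B x x = 0) (hB₂ : ∀ x ∈ L₂, B x x = 0) (hB₃ : ∀ x ∈ L₃, B x x = 0) :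
    ∀ x ∈ W, B x x = 0 := by
  have : FiniteDimensional K W := Module.finite_of_finrank_pos (by omega)
  have : FiniteDimensional K L₁ := Module.finite_of_finrank_pos (by omega)
  have : FiniteDimensional K L₂ := Module.finite_of_finrank_pos (by omega)
  have hsup : L₁ ⊔ L₂ = W := by
    refine Submodule.eq_of_le_of_finrank_le (sup_le hle₁ hle₂) ?_
    have : L₁ < L₁ ⊔ L₂ := left_lt_sup.2 fun h =>
      h12 (Submodule.eq_of_le_of_finrank_eq h (hL₂.trans hL₁.symm)).symm
    have := Submodule.finrank_lt_finrank_of_lt this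
    omega
  have hinf : Module.finrank K ↥(L₁ ⊓ L₂) = 1 := by
    have := Submodule.finrank_sup_add_finrank_inf_eq L₁ L₂
    rw [hsup] at this
    omega
  obtain ⟨u, hu₃, hu₁, hu₂⟩ := Submodule.exists_mem_notMem_notMem (L := L₃) (M := L₁) (N := L₂)
    (fun h => h13 (Submodule.eq_of_le_of_finrank_eq h (hL₃.trans hL₁.symm)).symm)
    (fun h => h23 (Submodule.eq_of_le_of_finrank_eq h (hL₃.trans hL₂.symm)).symm)
  obtain ⟨p, hp, q, hq, rfl⟩ := Submodule.mem_sup.1 (hsup.ge (hle₃ hu₃))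
  have hp₂ : p ∉ L₂ := fun h => hu₂ (L₂.add_mem h hq)
  have hq₁ : q ∉ L₁ := fun h => hu₁ (L₁.add_mem hp h)
  have polar_eq_zero {L : Submodule K V} (hL : ∀ x ∈ L, B x x = 0) {x y : V} (hx : x ∈ L)
      (hy : y ∈ L) : B x y + B y x = 0 := by
    have h := hL _ (L.add_mem hx hy)
    simp only [map_add, LinearMap.add_apply, hL x hx, hL y hy] at h
    linear_combination h
  have hpq : B p q + B q p = 0 := by
    have h := hB₃ _ hu₃
    simp only [map_add, LinearMap.add_apply, hB₁ p hp, hB₂ q hq] at h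
    linear_combination h
  intro x hx
  obtain ⟨y, hy, z, hz, rfl⟩ := Submodule.mem_sup.1 (hsup.ge hx)
  obtain ⟨d, hd, _, ha, rfl⟩ := Submodule.mem_sup.1
    (Submodule.le_sup_span_singleton_of_finrank_le inf_le_left (by omega) hp
      (fun h => hp₂ h.2) hy)
  obtain ⟨e, he, _, hb, rfl⟩ := Submodule.mem_sup.1
    (Submodule.le_sup_span_singleton_of_finrank_le inf_le_right (by omega) hq
      (fun h => hq₁ h.1) hz)
  obtain ⟨a, rfl⟩ := Submodule.mem_span_singleton.1 ha
  obtain ⟨b, rfl⟩ := Submodule.mem_span_singleton.1 hb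
  have hy0 := hB₁ _ hy
  have hz0 := hB₂ _ hz
  have hdz := polar_eq_zero hB₂ hd.2 hz
  have hpe := polar_eq_zero hB₁ hp he.1
  simp only [map_add, map_smul, LinearMap.add_apply, LinearMap.smul_apply, smul_eq_mul]
    at hy0 hz0 hdz hpe ⊢
  linear_combination hy0 + hz0 + hdz + a * hpe + a * b * hpq

/-- A quadric vanishing on three distinct lines inside a plane vanishes on
the whole plane (used in the proof of Lemma 5.1(e)). -/
theorem quadric_vanishes_on_plane_of_three_lines {K : Type*} [Field K]
    (f : MvPolynomial (Fin 4) K) (hf : f.IsHomogeneous 2)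
    (W L₁ L₂ L₃ : Submodule K (Fin 4 → K))
    (hW : Module.finrank K ↥W = 3)
    (hL₁ : Module.finrank K ↥L₁ = 2)
    (hL₂ : Module.finrank K ↥L₂ = 2)
    (hL₃ : Module.finrank K ↥L₃ = 2)
    (h12 : L₁ ≠ L₂) (h13 : L₁ ≠ L₃) (h23 : L₂ ≠ L₃)
    (hle₁ : L₁ ≤ W) (hle₂ : L₂ ≤ W) (hle₃ : L₃ ≤ W)
    (hvan : ∀ x ∈ (↑L₁ ∪ ↑L₂ ∪ ↑L₃ : Set (Fin 4 → K)),
      MvPolynomial.eval x f = 0) :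
    ∀ x ∈ W, MvPolynomial.eval x f = 0 := by
  obtain ⟨B, hB⟩ := hf.exists_bilinForm_eval_eq
  simp only [hB] at hvan ⊢
  exact B.apply_self_eq_zero_of_three_lines hW hL₁ hL₂ hL₃ h12 h13 h23 hle₁ hle₂ hle₃
    (fun x hx => hvan x (.inl (.inl hx))) (fun x hx => hvan x (.inl (.inr hx)))
    (fun x hx => hvan x (.inr hx))
end

section
/- Let K be a field and let v_0, …, v_9 be nonzero vectors in K^4. If some four of the ten vectors lie in a common 2-dimensional subspace of K^4 (i.e., four of the ten points are collinear), then there exists a nonzero homogeneous polynomial of degree 2 in 4 variables over K vanishing at all ten vectors. -/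
namespace MvPolynomial

/-- The homogeneous polynomials of degree `n` in `σ` variables form a space of dimension
`Nat.multichoose (card σ) n`. -/
theorem finrank_homogeneousSubmodule (σ K : Type*) [Fintype σ] [Field K] (n : ℕ) :
    Module.finrank K (homogeneousSubmodule σ K n) = (Fintype.card σ).multichoose n := by
  classical
  have hset : {d : σ →₀ ℕ | d.degree = n} =
      ((Finset.univ : Finset σ).finsuppAntidiag n : Set (σ →₀ ℕ)) := by
    ext d
    simp [Finset.mem_finsuppAntidiag, Finsupp.degree_eq_sum]
  rw [homogeneousSubmodule_eq_finsupp_supported, hset,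
    (AddMonoidAlgebra.supportedEquivFinsupp _).finrank_eq, Module.finrank_finsupp_self]
  simp [Finset.card_finsuppAntidiag_nat_eq_multichoose]

/-- Fewer points than the number of monomials of degree `n` lie on a hypersurface of
degree `n`. -/
theorem exists_isHomogeneous_eval_eq_zero {σ K : Type*} [Fintype σ] [Field K] {n : ℕ}
    (S : Finset (σ → K)) (hS : S.card < (Fintype.card σ).multichoose n) :
    ∃ f : MvPolynomial σ K, f ≠ 0 ∧ f.IsHomogeneous n ∧ ∀ x ∈ S, eval x f = 0 := by
  have : Module.Finite K (homogeneousSubmodule σ K n) :=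
    Module.Finite.iff_fg.mpr (homogeneousSubmodule_fg σ K n)
  let φ : homogeneousSubmodule σ K n →ₗ[K] S → K :=
    LinearMap.pi fun x => (aeval (x : σ → K)).toLinearMap ∘ₗ Submodule.subtype _
  have hφ : LinearMap.ker φ ≠ ⊥ := φ.ker_ne_bot_of_finrank_lt <| by
    simpa [finrank_homogeneousSubmodule] using hS
  obtain ⟨f, hf, hf0⟩ := Submodule.exists_mem_ne_zero_of_ne_bot hφ
  refine ⟨f, fun h => hf0 (Subtype.ext h), f.2, fun x hx => ?_⟩
  simpa [φ, aeval_eq_eval] using congrFun (LinearMap.mem_ker.mp hf) ⟨x, hx⟩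

theorem IsHomogeneous.eval_smul_add_smul_of_one {σ K : Type*} [CommRing K]
    {f : MvPolynomial σ K} (hf : f.IsHomogeneous 1) (s t : K) (a b : σ → K) :
    eval (s • a + t • b) f = s * eval a f + t * eval b f := by
  rw [← mem_homogeneousSubmodule, homogeneousSubmodule_one_eq_span_X] at hf
  induction hf using Submodule.span_induction with
  | mem x hx => obtain ⟨i, rfl⟩ := hx; simp
  | zero => simp
  | add x y _ _ hx hy => simp only [map_add, hx, hy]; ring
  | smul c x _ hx => simp only [smul_eval, hx]; ring

/-- A quadratic form on the span of `a` and `b` is determined by its values at `a`, `b` and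
`a + b`. -/
theorem IsHomogeneous.eval_smul_add_smul_of_two {σ K : Type*} [CommRing K]
    {f : MvPolynomial σ K} (hf : f.IsHomogeneous 2) (s t : K) (a b : σ → K) :
    eval (s • a + t • b) f = s ^ 2 * eval a f + t ^ 2 * eval b f +
      s * t * (eval (a + b) f - eval a f - eval b f) := by
  rw [← mem_homogeneousSubmodule, ← homogeneousSubmodule_one_pow, pow_two] at hf
  induction hf using Submodule.mul_induction_on' with
  | mem_mul_mem p hp q hq =>
    have hadd {r : MvPolynomial σ K} (hr : r.IsHomogeneous 1) :
        eval (a + b) r = eval a r + eval b r := by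
      simpa using hr.eval_smul_add_smul_of_one 1 1 a b
    rw [mem_homogeneousSubmodule] at hp hq
    simp only [map_mul, hp.eval_smul_add_smul_of_one, hq.eval_smul_add_smul_of_one, hadd hp,
      hadd hq]
    ring
  | add p _ q _ hp hq => simp only [map_add, hp, hq]; ring

end MvPolynomial

/-- Lemma 5.1(b): if four of the ten points are collinear (lie in a common
2-dimensional subspace of `K⁴`), then the ten points lie on a quadric. -/
theorem on_quadric_of_four_collinear {K : Type*} [Field K]
    (v : Fin 10 → Fin 4 → K) (hv : ∀ i, v i ≠ 0)
    (h : ∃ (i j k l : Fin 10) (W : Submodule K (Fin 4 → K)),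
      i ≠ j ∧ i ≠ k ∧ i ≠ l ∧ j ≠ k ∧ j ≠ l ∧ k ≠ l ∧
      Module.finrank K ↥W = 2 ∧ v i ∈ W ∧ v j ∈ W ∧ v k ∈ W ∧ v l ∈ W) :
    ∃ f : MvPolynomial (Fin 4) K, f ≠ 0 ∧ f.IsHomogeneous 2 ∧
      ∀ i, MvPolynomial.eval (v i) f = 0 := by
  classical
  obtain ⟨i, j, k, l, W, hij, hik, hil, hjk, hjl, hkl, hW, hi, hj, hk, hl⟩ := h
  let B := Module.finBasisOfFinrankEq K W hW
  let T : Finset (Fin 10) := {i, j, k, l}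
  let S : Finset (Fin 4 → K) :=
    Tᶜ.image v ∪ {(B 0 : Fin 4 → K), (B 1 : Fin 4 → K), (B 0 : Fin 4 → K) + B 1}
  have hS : S.card < (Fintype.card (Fin 4)).multichoose 2 := by
    have hT : T.card = 4 := by simp [T, *]
    calc S.card ≤ Tᶜ.card + 3 :=
          (Finset.card_union_le _ _).trans (add_le_add Finset.card_image_le Finset.card_le_three)
      _ = 9 := by rw [Finset.card_compl, hT, Fintype.card_fin]
      _ < _ := by simp [Nat.multichoose_eq, Nat.choose]
  obtain ⟨f, hf0, hf, hfS⟩ := MvPolynomial.exists_isHomogeneous_eval_eq_zero S hS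
  have hfW : ∀ x ∈ W, MvPolynomial.eval x f = 0 := fun x hx => by
    have hrepr := congrArg Subtype.val (B.sum_repr ⟨x, hx⟩)
    simp only [Fin.sum_univ_two, Submodule.coe_add, Submodule.coe_smul] at hrepr
    rw [← hrepr, hf.eval_smul_add_smul_of_two, hfS (B 0) (by simp [S]), hfS (B 1) (by simp [S]),
      hfS (B 0 + B 1) (by simp [S])]
    ring
  refine ⟨f, hf0, hf, fun m => ?_⟩
  by_cases hm : m ∈ T
  · simp only [T, Finset.mem_insert, Finset.mem_singleton] at hm
    rcases hm with rfl | rfl | rfl | rfl <;> exact hfW _ ‹_›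
  · exact hfS _ (Finset.mem_union_left _
      (Finset.mem_image_of_mem v (Finset.mem_compl.mpr hm)))
end

section
/- Let K be a field and let v_0, …, v_9 be nonzero vectors in K^4. Suppose there is a 3-dimensional subspace W of K^4 containing v_0, …, v_5 and a nonzero quadratic form on W vanishing at v_0, …, v_5 (i.e., six of the points lie on a degree-2 plane curve). Then there exists a nonzero homogeneous polynomial of degree 2 in 4 variables over K vanishing at all ten vectors v_0, …, v_9. -/
namespace QuadraticMap

/-- Every quadratic form on `ι → R` is the evaluation of a homogeneous polynomial of degree two. -/
theorem exists_isHomogeneous_eval_eq {ι R : Type*} [Finite ι] [CommRing R]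
    (Q : QuadraticForm R (ι → R)) :
    ∃ f : MvPolynomial ι R, f.IsHomogeneous 2 ∧ ∀ x, MvPolynomial.eval x f = Q x := by
  classical
  cases nonempty_fintype ι
  obtain ⟨B, rfl⟩ := LinearMap.BilinMap.toQuadraticMap_surjective Q
  refine ⟨∑ i, ∑ j, MvPolynomial.C (B (Pi.single i 1) (Pi.single j 1)) *
    (MvPolynomial.X i * MvPolynomial.X j), ?_, fun x ↦ ?_⟩
  · refine MvPolynomial.IsHomogeneous.sum _ _ _ fun i _ ↦
      MvPolynomial.IsHomogeneous.sum _ _ _ fun j _ ↦ ?_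
    simpa using (MvPolynomial.isHomogeneous_C ι _).mul
      ((MvPolynomial.isHomogeneous_X R i).mul (MvPolynomial.isHomogeneous_X R j))
  · rw [LinearMap.BilinMap.toQuadraticMap_apply]
    conv_rhs => rw [← LinearMap.sum_repr_mul_repr_mul (Pi.basisFun R ι) (Pi.basisFun R ι) x x]
    simp [Finsupp.sum_fintype, mul_comm, mul_left_comm, mul_assoc]

theorem linMulLin_ne_zero {R M A : Type*} [CommSemiring R] [AddCommMonoid M] [Module R M]
    [NonUnitalNonAssocSemiring A] [NoZeroDivisors A] [Module R A] [SMulCommClass R A A]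
    [IsScalarTower R A A] {f g : M →ₗ[R] A} (hf : f ≠ 0) (hg : g ≠ 0) : linMulLin f g ≠ 0 := by
  intro h
  obtain ⟨a, ha⟩ := DFunLike.ne_iff.mp hf
  obtain ⟨b, hb⟩ := DFunLike.ne_iff.mp hg
  have key (x : M) : f x = 0 ∨ g x = 0 := mul_eq_zero.mp (DFunLike.congr_fun h x)
  have hga := (key a).resolve_left ha
  have hfb := (key b).resolve_right hb
  rcases key (a + b) with h | h
  · exact ha (by simpa [hfb] using h)
  · exact hb (by simpa [hga] using h)

end QuadraticMap

/-- For a nonzero quadratic form `q` on a proper subspace `W`, an extension of `q` to the ambient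
space and a product of two linear forms, one of which vanishes on `W`, combine to a nonzero
quadratic form vanishing on the zeros of `q` and on any family of further points no larger than
the dimension. -/
theorem Submodule.exists_quadraticForm_ne_zero_vanishing {K V ι : Type*} [Field K]
    [AddCommGroup V] [Module K V] [FiniteDimensional K V] [Fintype ι]
    {W : Submodule K V} (hW : W < ⊤) {q : QuadraticForm K W} (hq : q ≠ 0)
    (p : ι → V) (hp : Fintype.card ι ≤ Module.finrank K V) :
    ∃ Q : QuadraticForm K V, Q ≠ 0 ∧ (∀ w : W, q w = 0 → Q w = 0) ∧ ∀ i, Q (p i) = 0 := by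
  obtain ⟨l, hl, hWl⟩ := W.exists_le_ker_of_lt_top hW
  obtain ⟨π, hπ⟩ := W.subtype.exists_leftInverse_of_injective W.ker_subtype
  have hπ' (w : W) : π w = w := DFunLike.congr_fun hπ w
  let T : K × Module.Dual K V →ₗ[K] ι → K := LinearMap.pi fun i ↦
    (LinearMap.fst K K (Module.Dual K V)).smulRight (q (π (p i))) +
      l (p i) • (Module.Dual.eval K V (p i)).comp (LinearMap.snd K K (Module.Dual K V))
  have hT : T.ker ≠ ⊥ := LinearMap.ker_ne_bot_of_finrank_lt (by
    simp [Module.finrank_prod, Subspace.dual_finrank_eq]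
    omega)
  obtain ⟨⟨c, m⟩, hcm, hne⟩ := T.ker.exists_mem_ne_zero_of_ne_bot hT
  have hlW (w : W) : l w = 0 := hWl w.2
  refine ⟨c • q.comp π + QuadraticMap.linMulLin l m, fun h ↦ hne ?_, fun w hw ↦ ?_, fun i ↦ ?_⟩
  · have hc : c = 0 := by
      refine (smul_eq_zero.mp (QuadraticMap.ext fun w ↦ ?_ : c • q = 0)).resolve_right hq
      simpa [hπ', hlW] using DFunLike.congr_fun h (w : V)
    have hm : m = 0 := by
      by_contra hm
      exact QuadraticMap.linMulLin_ne_zero hl hm (by simpa [hc] using h)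
    rw [hc, hm, Prod.mk_zero_zero]
  · simp [hπ', hlW, hw]
  · simpa [T] using congrFun (LinearMap.mem_ker.mp hcm) i

/-- Lemma 5.1(c): if six of the ten points lie on a degree-2 plane curve
(a nonzero quadratic form on a 3-dimensional subspace vanishing at the six
points), then all ten points lie on a quadric surface. -/
theorem on_quadric_of_six_on_plane_conic {K : Type*} [Field K]
    (v : Fin 10 → Fin 4 → K) (hv : ∀ i, v i ≠ 0)
    (W : Submodule K (Fin 4 → K)) (hW : Module.finrank K ↥W = 3)
    (hmem : ∀ i : Fin 10, (i : ℕ) < 6 → v i ∈ W)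
    (q : QuadraticForm K ↥W) (hq : q ≠ 0)
    (hvan : ∀ (i : Fin 10) (hi : (i : ℕ) < 6), q ⟨v i, hmem i hi⟩ = 0) :
    ∃ f : MvPolynomial (Fin 4) K, f ≠ 0 ∧ f.IsHomogeneous 2 ∧
      ∀ i, MvPolynomial.eval (v i) f = 0 := by
  have hW' : W < ⊤ := lt_top_iff_ne_top.mpr (by rintro rfl; simp at hW)
  obtain ⟨Q, hQ, hQW, hQp⟩ := Submodule.exists_quadraticForm_ne_zero_vanishing hW' hq
    (fun i : Fin 4 ↦ v (Fin.natAdd 6 i)) (by simp)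
  obtain ⟨f, hf, hfQ⟩ := QuadraticMap.exists_isHomogeneous_eval_eq Q
  refine ⟨f, ?_, hf, fun i ↦ ?_⟩
  · rintro rfl
    exact hQ (QuadraticMap.ext fun x ↦ by simp [← hfQ])
  · rw [hfQ]
    refine Fin.addCases (m := 6) (n := 4) (fun j ↦ ?_) hQp i
    exact hQW ⟨_, hmem _ j.2⟩ (hvan _ j.2)
end

section
/- Let K be a field and let a_1, b_1, a_2, b_2, a_3, b_3 be vectors in K^4 such that the three lines L_i = span{a_i, b_i} are pairwise skew, i.e., [a_1 b_1 a_2 b_2] ≠ 0, [a_1 b_1 a_3 b_3] ≠ 0, and [a_2 b_2 a_3 b_3] ≠ 0. Then the K-vector space of homogeneous polynomials of degree 2 in 4 variables over K that vanish at every vector of L_1 ∪ L_2 ∪ L_3 is 1-dimensional; in particular there is, up to scalar, a unique quadric surface containing the three skew lines. -/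
namespace MvPolynomial

variable {K : Type*} [Field K] {n : Type*} [Fintype n]

/-- The linear change of variables sending `p` to the polynomial `x ↦ p (x ᵥ* P)`. -/
noncomputable def linearSubst (P : Matrix n n K) : MvPolynomial n K →ₐ[K] MvPolynomial n K :=
  aeval fun i => ∑ j, C (P j i) * X j

theorem aeval_linearSubst (P : Matrix n n K) (p : MvPolynomial n K) (x : n → K) :
    aeval x (linearSubst P p) = aeval (Matrix.vecMul x P) p := by
  rw [linearSubst, ← AlgHom.comp_apply]
  congr 1
  ext i
  simp [Matrix.vecMul, dotProduct, mul_comm]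

theorem linearSubst_linearSubst [DecidableEq n] {P Q : Matrix n n K} (h : Q * P = 1)
    (p : MvPolynomial n K) : linearSubst Q (linearSubst P p) = p := by
  suffices (linearSubst Q).comp (linearSubst P) = AlgHom.id K _ from DFunLike.congr_fun this p
  ext1 i
  have hcoeff (j : n) : ∑ k, C (P k i) * (C (Q j k) * X j) =
      (C ((1 : Matrix n n K) j i) * X j : MvPolynomial n K) := by
    rw [← h, Matrix.mul_apply, map_sum, Finset.sum_mul]
    refine Finset.sum_congr rfl fun k _ => ?_
    rw [C_mul]
    ring
  simp only [AlgHom.comp_apply, linearSubst, aeval_X, map_sum, map_mul, algHom_C, algebraMap_eq,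
    Finset.mul_sum, AlgHom.id_apply]
  rw [Finset.sum_comm]
  simp [hcoeff, Matrix.one_apply]

theorem IsHomogeneous.linearSubst {p : MvPolynomial n K} {d : ℕ} (hp : p.IsHomogeneous d)
    (P : Matrix n n K) : (linearSubst P p).IsHomogeneous d := by
  have h := hp.aeval (fun i => ∑ j, C (P j i) * X j : n → MvPolynomial n K) (n := 1)
    fun i => IsHomogeneous.sum _ _ _ fun j _ => by
      simpa using (isHomogeneous_C n (P j i)).mul (isHomogeneous_X K j)
  rwa [one_mul] at h

theorem IsHomogeneous.exists_eq_sum_mul_X_mul_X {p : MvPolynomial n K}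
    (hp : p.IsHomogeneous 2) : ∃ c : n → n → K, p = ∑ i, ∑ j, C (c i j) * (X i * X j) := by
  let S : Submodule K (MvPolynomial n K) :=
    Submodule.span K (Set.range fun ij : n × n => X ij.1 * X ij.2)
  have hS : p ∈ S := by
    rw [p.as_sum]
    refine S.sum_mem fun d hd => ?_
    have hdeg : d.degree = 2 := by
      rw [← hp (mem_support_iff.mp hd), Finsupp.degree_eq_weight_one]
      rfl
    obtain ⟨i, hi⟩ : ∃ i, d i ≠ 0 := by
      by_contra! h
      simp [show d = 0 from Finsupp.ext h] at hdeg
    obtain ⟨e, rfl⟩ := exists_add_of_le (a := Finsupp.single i 1) (b := d)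
      (Finsupp.single_le_iff.mpr (Nat.one_le_iff_ne_zero.mpr hi))
    have he : e.degree = 1 := by
      rw [map_add, Finsupp.degree_single] at hdeg
      omega
    obtain ⟨j, rfl⟩ := Finsupp.range_single_one.ge he
    have : monomial (Finsupp.single i 1 + Finsupp.single j 1)
        (coeff (Finsupp.single i 1 + Finsupp.single j 1) p) =
        coeff (Finsupp.single i 1 + Finsupp.single j 1) p • (X i * X j : MvPolynomial n K) := by
      simp [X, monomial_mul, smul_monomial]
    rw [this]
    exact S.smul_mem _ (Submodule.subset_span ⟨(i, j), rfl⟩)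
  obtain ⟨c, hc⟩ := (Submodule.mem_span_range_iff_exists_fun K).mp hS
  refine ⟨fun i j => c (i, j), ?_⟩
  simp [← hc, Fintype.sum_prod_type, smul_eq_C_mul]

end MvPolynomial

open MvPolynomial

theorem span_pair_eq_of_det_ne_zero {K V : Type*} [Field K] [AddCommGroup V] [Module K V]
    (a b : V) {α β γ δ : K} (h : α * δ - β * γ ≠ 0) :
    Submodule.span K {α • a + β • b, γ • a + δ • b} = Submodule.span K {a, b} := by
  apply le_antisymm <;> rw [Submodule.span_le, Set.pair_subset_iff] <;>
    simp only [SetLike.mem_coe, Submodule.mem_span_pair]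
  · exact ⟨⟨α, β, rfl⟩, ⟨γ, δ, rfl⟩⟩
  · refine ⟨⟨δ / (α * δ - β * γ), -β / (α * δ - β * γ), ?_⟩,
      ⟨-γ / (α * δ - β * γ), α / (α * δ - β * γ), ?_⟩⟩
    · match_scalars
      · linear_combination mul_inv_cancel₀ h
      · ring
    · match_scalars
      · ring
      · linear_combination mul_inv_cancel₀ h

theorem eq_C_mul_of_vanishing_on_coordinate_lines {K : Type*} [Field K]
    {p : MvPolynomial (Fin 4) K} (hp : p.IsHomogeneous 2)
    (h₁ : ∀ s t : K, aeval ![s, t, 0, 0] p = 0) (h₂ : ∀ s t : K, aeval ![0, 0, s, t] p = 0)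
    (h₃ : ∀ s t : K, aeval ![s, t, s, t] p = 0) :
    ∃ c : K, p = C c * (X 0 * X 3 - X 1 * X 2) := by
  obtain ⟨c, rfl⟩ := hp.exists_eq_sum_mul_X_mul_X
  simp only [Fin.sum_univ_four] at h₁ h₂ h₃
  have e₁ := h₁ 1 0
  have e₂ := h₁ 0 1
  have e₃ := h₁ 1 1
  have e₄ := h₂ 1 0
  have e₅ := h₂ 0 1
  have e₆ := h₂ 1 1
  have e₇ := h₃ 1 0
  have e₈ := h₃ 0 1
  have e₉ := h₃ 1 1
  simp at e₁ e₂ e₃ e₄ e₅ e₆ e₇ e₈ e₉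
  have k₁ : c 1 0 = -c 0 1 := by linear_combination e₃ - e₁ - e₂
  have k₂ : c 3 2 = -c 2 3 := by linear_combination e₆ - e₄ - e₅
  have k₃ : c 2 0 = -c 0 2 := by linear_combination e₇ - e₁ - e₄
  have k₄ : c 3 1 = -c 1 3 := by linear_combination e₈ - e₂ - e₅
  have k₅ : c 2 1 = -c 0 3 - c 3 0 - c 1 2 := by linear_combination e₉ - e₃ - e₆ - k₃ - k₄
  refine ⟨c 0 3 + c 3 0, ?_⟩
  simp only [Fin.sum_univ_four, k₁, k₂, k₃, k₄, k₅, e₁, e₂, e₄, e₅, map_add, map_sub, map_neg,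
    map_zero]
  ring

theorem vecMul_of_vec_four {K : Type*} [CommRing K] (u u' v v' : Fin 4 → K) (s t s' t' : K) :
    Matrix.vecMul ![s, t, s', t'] (Matrix.of ![u, u', v, v']) =
      s • u + t • u' + s' • v + t' • v' := by
  ext i
  simp [Matrix.vecMul, dotProduct, Fin.sum_univ_four]

theorem finrank_quadrics_through_adapted_lines {K : Type*} [Field K] (u u' v v' : Fin 4 → K)
    (h : br u u' v v' ≠ 0) :
    Module.finrank K
      ↥(homogeneousSubmodule (Fin 4) K 2 ⊓
        ⨅ x ∈ ((Submodule.span K {u, u'} : Submodule K (Fin 4 → K)) ∪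
                Submodule.span K {v, v'} ∪
                Submodule.span K {u + v, u' + v'} : Set (Fin 4 → K)),
          LinearMap.ker (aeval x).toLinearMap) = 1 := by
  set P : Matrix (Fin 4) (Fin 4) K := Matrix.of ![u, u', v, v'] with hP
  have hunit : IsUnit P.det := isUnit_iff_ne_zero.mpr h
  have hPN : P * P⁻¹ = 1 := P.mul_nonsing_inv hunit
  have hNP : P⁻¹ * P = 1 := P.nonsing_inv_mul hunit
  let q : MvPolynomial (Fin 4) K := X 0 * X 3 - X 1 * X 2
  have hq : q.IsHomogeneous 2 :=
    ((isHomogeneous_X K 0).mul (isHomogeneous_X K 3)).sub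
      ((isHomogeneous_X K 1).mul (isHomogeneous_X K 2))
  have hq0 : q ≠ 0 := fun h0 => by
    simpa [q] using congrArg (aeval (![1, 0, 0, 1] : Fin 4 → K)) h0
  have heval (y : Fin 4 → K) :
      aeval (Matrix.vecMul y P) (linearSubst P⁻¹ q) = y 0 * y 3 - y 1 * y 2 := by
    rw [aeval_linearSubst, Matrix.vecMul_vecMul, hPN, Matrix.vecMul_one]
    simp [q]
  have hmem : linearSubst P⁻¹ q ∈ homogeneousSubmodule (Fin 4) K 2 ⊓
        ⨅ x ∈ ((Submodule.span K {u, u'} : Submodule K (Fin 4 → K)) ∪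
                Submodule.span K {v, v'} ∪
                Submodule.span K {u + v, u' + v'} : Set (Fin 4 → K)),
          LinearMap.ker (aeval x).toLinearMap := by
    simp only [Submodule.mem_inf, Submodule.mem_iInf, LinearMap.mem_ker, AlgHom.toLinearMap_apply,
      mem_homogeneousSubmodule]
    refine ⟨hq.linearSubst _, ?_⟩
    rintro x ((hx | hx) | hx) <;> obtain ⟨s, t, rfl⟩ := Submodule.mem_span_pair.mp hx
    · simpa [hP, vecMul_of_vec_four] using heval ![s, t, 0, 0]
    · simpa [hP, vecMul_of_vec_four] using heval ![0, 0, s, t]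
    · have := heval ![s, t, s, t]
      rw [hP, vecMul_of_vec_four] at this
      rw [show s • (u + v) + t • (u' + v') = s • u + t • u' + s • v + t • v' by module, this]
      simp [mul_comm]
  refine (finrank_eq_one_iff_of_nonzero' ⟨_, hmem⟩ fun h0 => hq0 ?_).mpr ?_
  · rw [← linearSubst_linearSubst hPN q, show linearSubst P⁻¹ q = 0 from Subtype.ext_iff.mp h0,
      map_zero]
  rintro ⟨w, hw⟩
  simp only [Submodule.mem_inf, Submodule.mem_iInf, LinearMap.mem_ker, AlgHom.toLinearMap_apply,
    mem_homogeneousSubmodule] at hw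
  obtain ⟨hw, hvan⟩ := hw
  obtain ⟨c, hc⟩ := eq_C_mul_of_vanishing_on_coordinate_lines (hw.linearSubst P)
    (fun s t => by
      rw [aeval_linearSubst, hP, vecMul_of_vec_four]
      exact hvan _ (.inl (.inl (Submodule.mem_span_pair.mpr ⟨s, t, by module⟩))))
    (fun s t => by
      rw [aeval_linearSubst, hP, vecMul_of_vec_four]
      exact hvan _ (.inl (.inr (Submodule.mem_span_pair.mpr ⟨s, t, by module⟩))))
    (fun s t => by
      rw [aeval_linearSubst, hP, vecMul_of_vec_four]
      exact hvan _ (.inr (Submodule.mem_span_pair.mpr ⟨s, t, by module⟩)))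
  refine ⟨c, Subtype.ext ?_⟩
  change c • linearSubst P⁻¹ q = w
  rw [← linearSubst_linearSubst hNP w, hc, ← smul_eq_C_mul, map_smul]

theorem br_linear_combination {K : Type*} [CommRing K] (T : Matrix (Fin 4) (Fin 4) K)
    (a b c d : Fin 4 → K) :
    br (T 0 0 • a + T 0 1 • b + T 0 2 • c + T 0 3 • d)
      (T 1 0 • a + T 1 1 • b + T 1 2 • c + T 1 3 • d)
      (T 2 0 • a + T 2 1 • b + T 2 2 • c + T 2 3 • d)
      (T 3 0 • a + T 3 1 • b + T 3 2 • c + T 3 3 • d) = T.det * br a b c d := by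
  rw [br, br, ← Matrix.det_mul]
  congr 1
  ext i j
  fin_cases i <;> simp [Matrix.mul_apply, Fin.sum_univ_four]

theorem exists_eq_linear_combination_of_br_ne_zero {K : Type*} [Field K] {a b c d : Fin 4 → K}
    (h : br a b c d ≠ 0) (x : Fin 4 → K) :
    ∃ α β γ δ : K, x = α • a + β • b + (γ • c + δ • d) := by
  set P : Matrix (Fin 4) (Fin 4) K := Matrix.of ![a, b, c, d] with hP
  let y := Matrix.vecMul x P⁻¹
  refine ⟨y 0, y 1, y 2, y 3, ?_⟩
  rw [← add_assoc, ← vecMul_of_vec_four, ← hP,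
    show ![y 0, y 1, y 2, y 3] = y by ext i; fin_cases i <;> rfl, Matrix.vecMul_vecMul,
    P.nonsing_inv_mul (isUnit_iff_ne_zero.mpr h), Matrix.vecMul_one]

/-- Existence and uniqueness (up to scalar) of the quadric through three
mutually skew lines: the space of homogeneous degree-2 polynomials vanishing
on the union of the three lines is 1-dimensional. -/
theorem quadric_through_three_skew_lines_unique {K : Type*} [Field K]
    (a₁ b₁ a₂ b₂ a₃ b₃ : Fin 4 → K)
    (h12 : br a₁ b₁ a₂ b₂ ≠ 0)
    (h13 : br a₁ b₁ a₃ b₃ ≠ 0)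
    (h23 : br a₂ b₂ a₃ b₃ ≠ 0) :
    Module.finrank K
      ↥(MvPolynomial.homogeneousSubmodule (Fin 4) K 2 ⊓
        ⨅ x ∈ ((Submodule.span K {a₁, b₁} : Submodule K (Fin 4 → K)) ∪
                Submodule.span K {a₂, b₂} ∪
                Submodule.span K {a₃, b₃} : Set (Fin 4 → K)),
          LinearMap.ker (MvPolynomial.aeval x).toLinearMap) = 1 := by
  obtain ⟨α, β, γ, δ, h₃⟩ := exists_eq_linear_combination_of_br_ne_zero h12 a₃
  obtain ⟨α', β', γ', δ', h₃'⟩ := exists_eq_linear_combination_of_br_ne_zero h12 b₃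
  subst h₃ h₃'
  have e13 := br_linear_combination !![1, 0, 0, 0; 0, 1, 0, 0; α, β, γ, δ; α', β', γ', δ']
    a₁ b₁ a₂ b₂
  have e23 := br_linear_combination !![0, 0, 1, 0; 0, 0, 0, 1; α, β, γ, δ; α', β', γ', δ']
    a₁ b₁ a₂ b₂
  have e := br_linear_combination !![α, β, 0, 0; α', β', 0, 0; 0, 0, γ, δ; 0, 0, γ', δ']
    a₁ b₁ a₂ b₂
  simp [Matrix.det_succ_row_zero, Fin.sum_univ_succ, Fin.succAbove, add_assoc] at e13 e23 e
  simp only [add_assoc] at h13 h23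
  have hγδ : γ * δ' - δ * γ' ≠ 0 := fun h0 => h13 <| by
    rw [e13]
    linear_combination br a₁ b₁ a₂ b₂ * h0
  have hαβ : α * β' - β * α' ≠ 0 := fun h0 => h23 <| by
    rw [e23]
    linear_combination br a₁ b₁ a₂ b₂ * h0
  rw [← span_pair_eq_of_det_ne_zero a₁ b₁ hαβ, ← span_pair_eq_of_det_ne_zero a₂ b₂ hγδ]
  refine finrank_quadrics_through_adapted_lines _ _ _ _ ?_
  rw [e]
  convert mul_ne_zero (mul_ne_zero hαβ hγδ) h12 using 2
  ring
end

section
/- Let K be a field and let a_1, b_1, a_2, b_2, a_3, b_3 be vectors in K^4 such that the three lines L_i = span{a_i, b_i} are pairwise skew, i.e., [a_1 b_1 a_2 b_2] ≠ 0, [a_1 b_1 a_3 b_3] ≠ 0, and [a_2 b_2 a_3 b_3] ≠ 0. Let f be a nonzero homogeneous polynomial of degree 2 in 4 variables over K vanishing at every vector of L_1 ∪ L_2 ∪ L_3, and let x be a nonzero vector in K^4. Then f(x) = 0 if and only if [x a_1 b_1 a_2]·[b_2 a_3 b_3 x] − [x a_1 b_1 b_2]·[a_2 a_3 b_3 x]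 = 0. -/
theorem br_vecMul {K : Type*} [CommRing K] (M : Matrix (Fin 4) (Fin 4) K) (a b c d : Fin 4 → K) :
    br (Matrix.vecMul a M) (Matrix.vecMul b M) (Matrix.vecMul c M) (Matrix.vecMul d M) =
      br a b c d * M.det := by
  rw [br, br, ← Matrix.det_mul]
  congr 1
  ext i j
  fin_cases i <;> rfl

theorem exists_vecMul_of_br_ne_zero {K : Type*} [Field K] {a b c d : Fin 4 → K}
    (h : br a b c d ≠ 0) (x : Fin 4 → K) :
    ∃ y : Fin 4 → K, x = Matrix.vecMul y (Matrix.of ![a, b, c, d]) := by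
  refine ⟨Matrix.vecMul x (Matrix.of ![a, b, c, d])⁻¹, ?_⟩
  rw [Matrix.vecMul_vecMul, Matrix.nonsing_inv_mul _ (isUnit_iff_ne_zero.mpr h),
    Matrix.vecMul_one]

theorem vecMul_of_four {K : Type*} [CommRing K] (a b c d y : Fin 4 → K) :
    Matrix.vecMul y (Matrix.of ![a, b, c, d]) =
      y 0 • a + y 1 • b + y 2 • c + y 3 • d := by
  ext j
  simp [Matrix.vecMul, dotProduct, Fin.sum_univ_four]

theorem MvPolynomial.IsHomogeneous.exists_bilinForm {K σ : Type*} [CommRing K]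
    {f : MvPolynomial σ K} (hf : f.IsHomogeneous 2) :
    ∃ B : LinearMap.BilinForm K (σ → K), ∀ x, MvPolynomial.eval x f = B x x := by
  classical
  have key : ∀ d : σ →₀ ℕ, d.degree = 2 →
      ∃ i j, d = Finsupp.single i 1 + Finsupp.single j 1 := by
    intro d hd
    have hcard : d.toMultiset.card = 2 := by
      rw [Finsupp.card_toMultiset]; exact hd
    obtain ⟨i, j, hij⟩ := Multiset.card_eq_two.mp hcard
    refine ⟨i, j, Multiset.toFinsupp.symm.injective ?_⟩
    change Finsupp.toMultiset d = Finsupp.toMultiset _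
    rw [hij, map_add, Finsupp.toMultiset_single, Finsupp.toMultiset_single]
    simp only [one_smul]
    rfl
  have mono : ∀ d : f.support, ∃ B : LinearMap.BilinForm K (σ → K),
      ∀ x, MvPolynomial.eval x (MvPolynomial.monomial d.1 (f.coeff d.1)) = B x x := by
    rintro ⟨d, hd⟩
    obtain ⟨i, j, rfl⟩ := key d (by
      rw [Finsupp.degree_eq_weight_one]
      exact hf (MvPolynomial.mem_support_iff.mp hd))
    refine ⟨f.coeff (Finsupp.single i 1 + Finsupp.single j 1) •
      LinearMap.BilinForm.linMulLin (LinearMap.proj i) (LinearMap.proj j), fun x => ?_⟩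
    rw [MvPolynomial.eval_monomial, Finsupp.prod_add_index' (by simp) (by simp [pow_add])]
    simp
  choose B hB using mono
  refine ⟨∑ d, B d, fun x => ?_⟩
  conv_lhs => rw [f.as_sum, map_sum, ← Finset.sum_coe_sort]
  simp [LinearMap.sum_apply, ← hB]

/-- A form vanishing on two complementary planes pairs only their coordinates with each other. -/
theorem LinearMap.BilinForm.apply_self_of_isotropic_planes {K V : Type*} [CommRing K]
    [AddCommGroup V] [Module K V] (B : LinearMap.BilinForm K V) {a b c d : V}
    (hab : ∀ s t : K, B (s • a + t • b) (s • a + t • b) = 0)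
    (hcd : ∀ s t : K, B (s • c + t • d) (s • c + t • d) = 0) (s t u v : K) :
    B (s • a + t • b + u • c + v • d) (s • a + t • b + u • c + v • d) =
      s * u * (B a c + B c a) + s * v * (B a d + B d a) +
      t * u * (B b c + B c b) + t * v * (B b d + B d b) := by
  have h₁ := hab s t
  have h₂ := hcd u v
  simp only [map_add, map_smul, LinearMap.add_apply, LinearMap.smul_apply, smul_eq_mul]
    at h₁ h₂ ⊢
  linear_combination h₁ + h₂

/-- Grassmann's criterion (used in Lemma 5.1(d)): a point `x` lies on the
quadric through three mutually skew lines iff `x L₁ L₂ L₃ x = 0`, i.e.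
`[x a₁ b₁ a₂]·[b₂ a₃ b₃ x] − [x a₁ b₁ b₂]·[a₂ a₃ b₃ x] = 0`. -/
theorem grassmann_criterion {K : Type*} [Field K]
    (a₁ b₁ a₂ b₂ a₃ b₃ : Fin 4 → K)
    (h12 : br a₁ b₁ a₂ b₂ ≠ 0)
    (h13 : br a₁ b₁ a₃ b₃ ≠ 0)
    (h23 : br a₂ b₂ a₃ b₃ ≠ 0)
    (f : MvPolynomial (Fin 4) K) (hf0 : f ≠ 0) (hf : f.IsHomogeneous 2)
    (hvan : ∀ y ∈ ((Submodule.span K {a₁, b₁} : Submodule K (Fin 4 → K)) ∪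
        Submodule.span K {a₂, b₂} ∪
        Submodule.span K {a₃, b₃} : Set (Fin 4 → K)),
      MvPolynomial.eval y f = 0)
    (x : Fin 4 → K) (hx : x ≠ 0) :
    MvPolynomial.eval x f = 0 ↔
      br x a₁ b₁ a₂ * br b₂ a₃ b₃ x - br x a₁ b₁ b₂ * br a₂ a₃ b₃ x = 0 := by
  obtain ⟨B, hB⟩ := hf.exists_bilinForm
  have line : ∀ {a b : Fin 4 → K},
      (∀ y ∈ Submodule.span K {a, b}, MvPolynomial.eval y f = 0) →
      ∀ s t : K, B (s • a + t • b) (s • a + t • b) = 0 := fun h s t => by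
    rw [← hB]
    exact h _ (Submodule.mem_span_pair.mpr ⟨s, t, rfl⟩)
  have hL₁ := line fun y hy => hvan y (Or.inl (Or.inl hy))
  have hL₂ := line fun y hy => hvan y (Or.inl (Or.inr hy))
  have hL₃ := line fun y hy => hvan y (Or.inr hy)
  have expand := B.apply_self_of_isotropic_planes hL₁ hL₂
  set p := B a₁ a₂ + B a₂ a₁
  set q := B a₁ b₂ + B b₂ a₁
  set r := B b₁ a₂ + B a₂ b₁
  set w := B b₁ b₂ + B b₂ b₁
  set M := Matrix.of ![a₁, b₁, a₂, b₂] with hM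
  have coord : ∀ y : Fin 4 → K, B (Matrix.vecMul y M) (Matrix.vecMul y M) =
      y 0 * y 2 * p + y 0 * y 3 * q + y 1 * y 2 * r + y 1 * y 3 * w := fun y => by
    rw [hM, vecMul_of_four, expand]
  have ha₁ : a₁ = Matrix.vecMul ![1, 0, 0, 0] M := by simp [hM]
  have hb₁ : b₁ = Matrix.vecMul ![0, 1, 0, 0] M := by simp [hM]
  have ha₂ : a₂ = Matrix.vecMul ![0, 0, 1, 0] M := by simp [hM]
  have hb₂ : b₂ = Matrix.vecMul ![0, 0, 0, 1] M := by simp [hM]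
  obtain ⟨α, hα⟩ := exists_vecMul_of_br_ne_zero h12 a₃
  obtain ⟨β, hβ⟩ := exists_vecMul_of_br_ne_zero h12 b₃
  obtain ⟨ξ, hξ⟩ := exists_vecMul_of_br_ne_zero h12 x
  rw [← hM] at hα hβ hξ
  have hdet : M.det ≠ 0 := h12
  clear_value M
  have hY : α 2 * β 3 - α 3 * β 2 ≠ 0 := by
    rw [ha₁, hb₁, hα, hβ, br_vecMul, br_eq] at h13
    simpa using left_ne_zero_of_mul h13
  have hX : α 0 * β 1 - α 1 * β 0 ≠ 0 := by
    rw [ha₂, hb₂, hα, hβ, br_vecMul, br_eq] at h23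
    simpa using left_ne_zero_of_mul h23
  have hαα : α 0 * α 2 * p + α 0 * α 3 * q + α 1 * α 2 * r + α 1 * α 3 * w = 0 := by
    rw [← coord, ← hα]
    simpa using hL₃ 1 0
  have hββ : β 0 * β 2 * p + β 0 * β 3 * q + β 1 * β 2 * r + β 1 * β 3 * w = 0 := by
    rw [← coord, ← hβ]
    simpa using hL₃ 0 1
  have hαβ := coord (α + β)
  rw [Matrix.add_vecMul, ← hα, ← hβ] at hαβ
  have hsum : B (a₃ + b₃) (a₃ + b₃) = 0 := by simpa using hL₃ 1 1
  rw [hsum] at hαβ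
  simp only [Pi.add_apply] at hαβ
  obtain ⟨k, hk⟩ : ∃ k, k = α 0 * β 2 * p + α 0 * β 3 * q + α 1 * β 2 * r + α 1 * β 3 * w :=
    ⟨_, rfl⟩
  have hk' : β 0 * α 2 * p + β 0 * α 3 * q + β 1 * α 2 * r + β 1 * α 3 * w = -k := by
    linear_combination -hαβ - hαα - hββ + hk
  have hXY := mul_ne_zero hX hY
  have hp : (α 0 * β 1 - α 1 * β 0) * (α 2 * β 3 - α 3 * β 2) * p =
      -k * (β 1 * α 3 - α 1 * β 3) := by
    linear_combination β 1 * β 3 * hαα + α 1 * α 3 * hββ - α 1 * β 3 * hk' + β 1 * α 3 * hk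
  have hq : (α 0 * β 1 - α 1 * β 0) * (α 2 * β 3 - α 3 * β 2) * q =
      k * (β 1 * α 2 - α 1 * β 2) := by
    linear_combination -β 1 * β 2 * hαα - α 1 * α 2 * hββ + α 1 * β 2 * hk' - β 1 * α 2 * hk
  have hr : (α 0 * β 1 - α 1 * β 0) * (α 2 * β 3 - α 3 * β 2) * r =
      k * (β 0 * α 3 - α 0 * β 3) := by
    linear_combination -β 0 * β 3 * hαα - α 0 * α 3 * hββ + α 0 * β 3 * hk' - β 0 * α 3 * hk
  have hw : (α 0 * β 1 - α 1 * β 0) * (α 2 * β 3 - α 3 * β 2) * w =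
      -k * (β 0 * α 2 - α 0 * β 2) := by
    linear_combination β 0 * β 2 * hαα + α 0 * α 2 * hββ - α 0 * β 2 * hk' + β 0 * α 2 * hk
  have hk0 : k ≠ 0 := by
    intro h0
    simp only [h0, neg_zero, zero_mul, mul_eq_zero, hX, hY, false_or] at hp hq hr hw
    refine hf0 (hf.eq_zero_of_forall_eval_eq_zero_of_le_card (fun y => ?_) ?_)
    · obtain ⟨z, hz⟩ := exists_vecMul_of_br_ne_zero h12 y
      rw [hB, hz, ← hM, coord, hp, hq, hr, hw]
      ring
    · exact_mod_cast Cardinal.two_le_iff.mpr ⟨0, 1, zero_ne_one⟩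
  have hG : br x a₁ b₁ a₂ * br b₂ a₃ b₃ x - br x a₁ b₁ b₂ * br a₂ a₃ b₃ x =
      M.det ^ 2 * (ξ 0 * ξ 2 * (β 1 * α 3 - α 1 * β 3) - ξ 0 * ξ 3 * (β 1 * α 2 - α 1 * β 2)
        - ξ 1 * ξ 2 * (β 0 * α 3 - α 0 * β 3) + ξ 1 * ξ 3 * (β 0 * α 2 - α 0 * β 2)) := by
    rw [ha₁, hb₁, ha₂, hb₂, hα, hβ, hξ]
    simp only [br_vecMul]
    simp only [br_eq]
    simp
    ring
  have main : (α 0 * β 1 - α 1 * β 0) * (α 2 * β 3 - α 3 * β 2) * M.det ^ 2 *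
      MvPolynomial.eval x f =
      -k * (br x a₁ b₁ a₂ * br b₂ a₃ b₃ x - br x a₁ b₁ b₂ * br a₂ a₃ b₃ x) := by
    rw [hG, hB, hξ, coord]
    linear_combination M.det ^ 2 *
      (ξ 0 * ξ 2 * hp + ξ 0 * ξ 3 * hq + ξ 1 * ξ 2 * hr + ξ 1 * ξ 3 * hw)
  rw [← mul_eq_zero_iff_left (mul_ne_zero hXY (pow_ne_zero 2 hdet)), main,
    mul_eq_zero_iff_left (neg_ne_zero.mpr hk0)]
end

section
/- Let K be a field of characteristic zero and let v_0, v_1, v_2, v_3, v_4, v_5 be nonzero vectors in K^4 such that [v_0 v_1 v_2 v_3] ≠ 0, [v_0 v_1 v_4 v_5] ≠ 0, and [v_2 v_3 v_4 v_5] ≠ 0 (i.e., the lines 01, 23, 45 are mutually skew). Then the six points impose independent conditions on quadrics: the K-vector space of homogeneous polynomials of degree 2 in 4 variables over K that vanish at all six vectors has dimension 4. -/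
open MvPolynomial

lemma br_swap {K : Type*} [CommRing K] (a b c d : Fin 4 → K) : br b a c d = -br a b c d := by
  simp [br, Matrix.det_succ_row_zero, Fin.sum_univ_succ, Fin.succAbove]
  ring

lemma br_swap_pairs {K : Type*} [CommRing K] (a b c d : Fin 4 → K) :
    br c d a b = br a b c d := by
  simp [br, Matrix.det_succ_row_zero, Fin.sum_univ_succ, Fin.succAbove]
  ring

/-- Every linear functional on `σ → K` is evaluation of a linear form. -/
lemma exists_isHomogeneous_one_aeval_eq {σ K : Type*} [Fintype σ] [CommRing K]
    (f : (σ → K) →ₗ[K] K) :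
    ∃ p : MvPolynomial σ K, p.IsHomogeneous 1 ∧ ∀ x, aeval x p = f x := by
  classical
  refine ⟨∑ j, C (f (Pi.single j 1)) * X j,
    IsHomogeneous.sum _ _ _ fun j _ ↦ isHomogeneous_C_mul_X _ _, fun x ↦ ?_⟩
  rw [LinearMap.pi_apply_eq_sum_univ f x]
  simp [mul_comm, ← Pi.single_apply, Pi.single_comm]

/-- The equation of the plane through three points is a linear form. -/
lemma exists_isHomogeneous_one_aeval_eq_br {K : Type*} [CommRing K] (a b c : Fin 4 → K) :
    ∃ p : MvPolynomial (Fin 4) K, p.IsHomogeneous 1 ∧ ∀ x, aeval x p = br x a b c := by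
  obtain ⟨p, hp, h⟩ := exists_isHomogeneous_one_aeval_eq
    ((Matrix.detRowAlternating (R := K)).toMultilinearMap.toLinearMap ![0, a, b, c] 0)
  refine ⟨p, hp, fun x ↦ (h x).trans ?_⟩
  have : Function.update ![0, a, b, c] 0 x = ![x, a, b, c] := by
    ext i
    fin_cases i <;> rfl
  simp only [MultilinearMap.toLinearMap_apply, this]
  rfl

lemma br_self_eq_zero {K : Type*} [CommRing K] (a b c : Fin 4 → K) :
    br a a b c = 0 ∧ br a b a c = 0 ∧ br a b c a = 0 :=
  ⟨Matrix.det_zero_of_row_eq (i := 0) (j := 1) (by decide) rfl,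
    Matrix.det_zero_of_row_eq (i := 0) (j := 2) (by decide) rfl,
    Matrix.det_zero_of_row_eq (i := 0) (j := 3) (by decide) rfl⟩

/-- The union of the planes `pab` and `pcd` is a quadric through `p, a, b, c, d` that avoids `x`. -/
lemma exists_quadric {K : Type*} [Field K] (x p a b c d : Fin 4 → K)
    (h₁ : br x p a b ≠ 0) (h₂ : br x p c d ≠ 0) :
    ∃ q : MvPolynomial (Fin 4) K, q.IsHomogeneous 2 ∧ aeval x q ≠ 0 ∧ aeval p q = 0 ∧
      aeval a q = 0 ∧ aeval b q = 0 ∧ aeval c q = 0 ∧ aeval d q = 0 := by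
  obtain ⟨q₁, hq₁, e₁⟩ := exists_isHomogeneous_one_aeval_eq_br p a b
  obtain ⟨q₂, hq₂, e₂⟩ := exists_isHomogeneous_one_aeval_eq_br p c d
  refine ⟨q₁ * q₂, hq₁.mul hq₂, ?_⟩
  simp only [map_mul, e₁, e₂]
  exact ⟨mul_ne_zero h₁ h₂, by simp [br_self_eq_zero]⟩

lemma finrank_homogeneousSubmodule {σ K : Type*} [Fintype σ] [CommRing K] [Nontrivial K] (n : ℕ) :
    Module.finrank K (homogeneousSubmodule σ K n) = (Fintype.card σ).multichoose n := by
  classical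
  have hs : {d : σ →₀ ℕ | d.degree = n} = ↑(Finset.univ.finsuppAntidiag n : Finset (σ →₀ ℕ)) := by
    ext d
    simp [Finsupp.degree_eq_sum]
  rw [homogeneousSubmodule_eq_finsupp_supported, hs,
    (AddMonoidAlgebra.supportedEquivFinsupp _).finrank_eq, Module.finrank_finsupp_self]
  simp [Finset.card_finsuppAntidiag_nat_eq_multichoose]

/-- If points are separated by forms of degree `n`, they impose independent conditions on them. -/
lemma finrank_homogeneousSubmodule_inf_ker {σ ι K : Type*} [Fintype σ] [Fintype ι] [Field K]
    (n : ℕ) (v : ι → σ → K)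
    (h : ∀ i, ∃ q : MvPolynomial σ K, q.IsHomogeneous n ∧ aeval (v i) q ≠ 0 ∧
      ∀ j, j ≠ i → aeval (v j) q = 0) :
    Fintype.card ι + Module.finrank K
      ↥(homogeneousSubmodule σ K n ⊓ ⨅ i, LinearMap.ker (aeval (v i)).toLinearMap) =
      (Fintype.card σ).multichoose n := by
  classical
  let E : homogeneousSubmodule σ K n →ₗ[K] ι → K :=
    (LinearMap.pi fun i ↦ (aeval (v i)).toLinearMap).domRestrict _
  have hE : LinearMap.range E = ⊤ := by
    rw [eq_top_iff, ← (Pi.basisFun K ι).span_eq, Submodule.span_le]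
    rintro _ ⟨i, rfl⟩
    obtain ⟨q, hq, hi, hj⟩ := h i
    refine ⟨(aeval (v i) q)⁻¹ • ⟨q, hq⟩, ?_⟩
    ext j
    by_cases hji : j = i
    · subst hji
      simpa [E] using inv_mul_cancel₀ hi
    · simp [E, hji, hj j hji]
  have hfin : Module.Finite K (homogeneousSubmodule σ K n) :=
    Module.Finite.iff_fg.mpr (homogeneousSubmodule_fg _ _ n)
  have hker : (LinearMap.ker E).map (homogeneousSubmodule σ K n).subtype =
      homogeneousSubmodule σ K n ⊓ ⨅ i, LinearMap.ker (aeval (v i)).toLinearMap := by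
    rw [LinearMap.ker_domRestrict, LinearMap.ker_pi, Submodule.map_comap_subtype]
  have := E.finrank_range_add_finrank_ker
  rwa [hE, finrank_top, Module.finrank_fintype_fun_eq_card, finrank_homogeneousSubmodule,
    ← Submodule.finrank_map_subtype_eq, hker] at this

/-- If the lines `01`, `23`, `45` are mutually skew, the six points impose
independent conditions on quadrics: the space of homogeneous degree-2
polynomials vanishing at all six points has dimension 4. -/
theorem six_points_impose_independent_conditions {K : Type*} [Field K]
    [CharZero K] (v : Fin 6 → Fin 4 → K) (hv : ∀ i, v i ≠ 0)
    (h0123 : br (v 0) (v 1) (v 2) (v 3) ≠ 0)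
    (h0145 : br (v 0) (v 1) (v 4) (v 5) ≠ 0)
    (h2345 : br (v 2) (v 3) (v 4) (v 5) ≠ 0) :
    Module.finrank K
      ↥(MvPolynomial.homogeneousSubmodule (Fin 4) K 2 ⊓
        ⨅ i : Fin 6, LinearMap.ker (MvPolynomial.aeval (v i)).toLinearMap) = 4 := by
  suffices h : ∀ i, ∃ q : MvPolynomial (Fin 4) K, q.IsHomogeneous 2 ∧ aeval (v i) q ≠ 0 ∧
      ∀ j, j ≠ i → aeval (v j) q = 0 by
    have := finrank_homogeneousSubmodule_inf_ker 2 v h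
    simp only [Fintype.card_fin, show Nat.multichoose 4 2 = 10 by simp [Nat.multichoose_eq, Nat.choose]] at this
    omega
  have key (i p a b c d : Fin 6) (h₁ : br (v i) (v p) (v a) (v b) ≠ 0)
      (h₂ : br (v i) (v p) (v c) (v d) ≠ 0)
      (hmem : ∀ j, j ≠ i → j = p ∨ j = a ∨ j = b ∨ j = c ∨ j = d) :
      ∃ q : MvPolynomial (Fin 4) K, q.IsHomogeneous 2 ∧ aeval (v i) q ≠ 0 ∧
        ∀ j, j ≠ i → aeval (v j) q = 0 := by
    obtain ⟨q, hq, hi, hp, ha, hb, hc, hd⟩ := exists_quadric _ _ _ _ _ _ h₁ h₂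
    refine ⟨q, hq, hi, fun j hj ↦ ?_⟩
    rcases hmem j hj with rfl | rfl | rfl | rfl | rfl <;> assumption
  have swap {a b c d : Fin 4 → K} (h : br a b c d ≠ 0) : br b a c d ≠ 0 := by
    rwa [br_swap, neg_ne_zero]
  have h2301 := (br_swap_pairs (v 0) (v 1) (v 2) (v 3)).trans_ne h0123
  have h4501 := (br_swap_pairs (v 0) (v 1) (v 4) (v 5)).trans_ne h0145
  have h4523 := (br_swap_pairs (v 2) (v 3) (v 4) (v 5)).trans_ne h2345
  intro i
  fin_cases i
  · exact key 0 1 2 3 4 5 h0123 h0145 (by decide)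
  · exact key 1 0 2 3 4 5 (swap h0123) (swap h0145) (by decide)
  · exact key 2 3 0 1 4 5 h2301 h2345 (by decide)
  · exact key 3 2 0 1 4 5 (swap h2301) (swap h2345) (by decide)
  · exact key 4 5 0 1 2 3 h4501 h4523 (by decide)
  · exact key 5 4 0 1 2 3 (swap h4501) (swap h4523) (by decide)
end

section
/- Let K be a field of characteristic zero, let e_0, e_1, e_2, e_3 be the standard basis of K^4, and set v_0 = e_0, v_1 = e_1, v_2 = e_2, v_3 = e_3, v_4 = (x_4, y_4, z_4, w_4), v_5 = (x_5, y_5, z_5, w_5). For vectors a,b,c, let [a b c X] denote the linear form X ↦ det(a,b,c,X) on K^4. Then the four homogeneous degree-2 polynomials [v_0 v_1 v_5 X][v_2 v_3 v_4 X], [v_0 v_1 v_2 X][v_3 v_4 v_5 X], [v_0 v_2 v_4 X][v_1 v_3 v_5 X], [v_0 v_4 v_5 X][v_1 v_2 v_3 X] are linearly dependent over K if and only if Q = −x_5 y_4 z_5 w_4 + x_4 y_5 z_5 w_4 + x_5 y_4 z_4 w_5 − x_4 y_4 z_5 w_5 equals 0. -/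
open MvPolynomial

/-- The linear form `X ↦ [a b c X]` as a polynomial in four variables:
the determinant of the 4×4 matrix whose columns (equivalently rows) are
`a`, `b`, `c`, and the variable point `X`. -/
noncomputable def linForm {K : Type*} [CommRing K] (a b c : Fin 4 → K) :
    MvPolynomial (Fin 4) K :=
  (Matrix.of ![fun j => (C (a j) : MvPolynomial (Fin 4) K),
               fun j => (C (b j) : MvPolynomial (Fin 4) K),
               fun j => (C (c j) : MvPolynomial (Fin 4) K),
               fun j => (X j : MvPolynomial (Fin 4) K)]).det

/-- Vectors in `K^m` are linearly independent exactly when some maximal minor of the matrix they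
form is nonzero. -/
theorem linearIndependent_iff_exists_minor_ne_zero {K : Type*} [Field K] {n m : ℕ}
    (A : Matrix (Fin n) (Fin m) K) :
    LinearIndependent K A.row ↔ ∃ f : Fin n ↪o Fin m, (A.submatrix id f).det ≠ 0 := by
  constructor
  · intro h
    have hrank : A.rank = n := by simpa using h.rank_matrix
    obtain ⟨κ, a, ha, hspan, hli⟩ := exists_linearIndependent' K A.col
    have : Finite κ := Finite.of_injective a ha
    have := Fintype.ofFinite κ
    have hcard : Fintype.card κ = n := by
      rw [← finrank_span_eq_card hli, hspan, ← A.rank_eq_finrank_span_cols, hrank]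
    have hS : (Finset.univ.image a).card = n := by
      rw [Finset.card_image_of_injective _ ha, Finset.card_univ, hcard]
    let f := (Finset.univ.image a).orderEmbOfFin hS
    refine ⟨f, ?_⟩
    have hon : LinearIndepOn K A.col (Set.range f) := by
      have : Set.range f = Set.range a := by simp [f]
      rw [this]
      exact (linearIndepOn_range_iff ha A.col).2 hli
    have hf : LinearIndependent K (A.submatrix id f).col :=
      (linearIndepOn_range_iff f.injective A.col).1 hon
    have hu := Matrix.linearIndependent_cols_iff_isUnit.1 hf
    exact ((Matrix.isUnit_iff_isUnit_det _).1 hu).ne_zero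
  · rintro ⟨f, hf⟩
    have hu := (Matrix.isUnit_iff_isUnit_det _).2 (isUnit_iff_ne_zero.2 hf)
    have hli : LinearIndependent K (A.submatrix id f).row :=
      Matrix.linearIndependent_rows_iff_isUnit.2 hu
    exact LinearIndependent.of_comp (LinearMap.funLeft K K f) hli

/-- The products `v i * v j` with `i < j`, in lexicographic order. -/
def pairProd {R : Type*} [Mul R] (v : Fin 4 → R) : Fin 6 → R :=
  ![v 0 * v 1, v 0 * v 2, v 0 * v 3, v 1 * v 2, v 1 * v 3, v 2 * v 3]

theorem linearIndependent_pairProd_X (K : Type*) [CommRing K] :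
    LinearIndependent K (pairProd (X : Fin 4 → MvPolynomial (Fin 4) K)) := by
  let e : Fin 6 → Fin 4 →₀ ℕ :=
    ![.single 0 1 + .single 1 1, .single 0 1 + .single 2 1, .single 0 1 + .single 3 1,
      .single 1 1 + .single 2 1, .single 1 1 + .single 3 1, .single 2 1 + .single 3 1]
  have he : Function.Injective e := by
    refine Function.Injective.of_comp (f := fun v : Fin 4 →₀ ℕ => (v : Fin 4 → ℕ)) ?_
    have : (fun v : Fin 4 →₀ ℕ => (v : Fin 4 → ℕ)) ∘ e =
        ![![1, 1, 0, 0], ![1, 0, 1, 0], ![1, 0, 0, 1],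
          ![0, 1, 1, 0], ![0, 1, 0, 1], ![0, 0, 1, 1]] := by
      ext i j
      fin_cases i <;> fin_cases j <;> simp [e]
    rw [this]
    decide
  have hX : pairProd (X : Fin 4 → MvPolynomial (Fin 4) K) = basisMonomials (Fin 4) K ∘ e := by
    funext i
    fin_cases i <;> simp [pairProd, e, X, monomial_mul]
  rw [hX]
  exact (basisMonomials (Fin 4) K).linearIndependent.comp e he

/-- The coordinates of the four quadrics with respect to `pairProd X`, where `a` and `b` are
the two points off the standard basis. -/
def quadricCoeff {K : Type*} [CommRing K] (a b : Fin 4 → K) : Matrix (Fin 4) (Fin 6) K :=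
  !![0, a 1 * b 3, -(a 1 * b 2), -(a 0 * b 3), a 0 * b 2, 0;
     0, 0, -(a 1 * b 2 - a 2 * b 1), 0, a 0 * b 2 - a 2 * b 0, -(a 0 * b 1 - a 1 * b 0);
     a 3 * b 2, 0, -(a 1 * b 2), -(a 3 * b 0), 0, a 1 * b 0;
     -(a 2 * b 3 - a 3 * b 2), a 1 * b 3 - a 3 * b 1, -(a 1 * b 2 - a 2 * b 1), 0, 0, 0]

theorem linForm_eq {K : Type*} [CommRing K] (a b c : Fin 4 → K) :
    linForm a b c =
      -C (a 1 * (b 2 * c 3 - b 3 * c 2) - a 2 * (b 1 * c 3 - b 3 * c 1)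
          + a 3 * (b 1 * c 2 - b 2 * c 1)) * X 0
      + C (a 0 * (b 2 * c 3 - b 3 * c 2) - a 2 * (b 0 * c 3 - b 3 * c 0)
          + a 3 * (b 0 * c 2 - b 2 * c 0)) * X 1
      - C (a 0 * (b 1 * c 3 - b 3 * c 1) - a 1 * (b 0 * c 3 - b 3 * c 0)
          + a 3 * (b 0 * c 1 - b 1 * c 0)) * X 2
      + C (a 0 * (b 1 * c 2 - b 2 * c 1) - a 1 * (b 0 * c 2 - b 2 * c 0)
          + a 2 * (b 0 * c 1 - b 1 * c 0)) * X 3 := by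
  simp only [linForm, Matrix.det_succ_row_zero, Fin.sum_univ_succ]
  simp [Fin.succAbove]
  ring

theorem quadrics_eq_linearCombination {K : Type*} [CommRing K] (a b : Fin 4 → K) :
    ![linForm (Pi.single 0 1) (Pi.single 1 1) b * linForm (Pi.single 2 1) (Pi.single 3 1) a,
      linForm (Pi.single 0 1) (Pi.single 1 1) (Pi.single 2 1) * linForm (Pi.single 3 1) a b,
      linForm (Pi.single 0 1) (Pi.single 2 1) a * linForm (Pi.single 1 1) (Pi.single 3 1) b,
      linForm (Pi.single 0 1) a b *
        linForm (Pi.single 1 1) (Pi.single 2 1) (Pi.single 3 1)] =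
      Fintype.linearCombination K (pairProd (X : Fin 4 → MvPolynomial (Fin 4) K)) ∘
        (quadricCoeff a b).row := by
  funext i
  rw [Function.comp_apply, Fintype.linearCombination_apply]
  fin_cases i <;>
    simp [linForm_eq, Fin.sum_univ_succ, pairProd, quadricCoeff, smul_eq_C_mul] <;>
    ring

/-- The polynomial `Q` of the dependency criterion. -/
def quadricQ {K : Type*} [CommRing K] (a b : Fin 4 → K) : K :=
  -(b 0 * a 1 * b 2 * a 3) + a 0 * b 1 * b 2 * a 3
    + b 0 * a 1 * a 2 * b 3 - a 0 * a 1 * b 2 * b 3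

theorem det_fin_four {R : Type*} [CommRing R] (M : Matrix (Fin 4) (Fin 4) R) :
    M.det =
      M 0 0 * (M 1 1 * (M 2 2 * M 3 3 - M 2 3 * M 3 2) - M 1 2 * (M 2 1 * M 3 3 - M 2 3 * M 3 1)
        + M 1 3 * (M 2 1 * M 3 2 - M 2 2 * M 3 1))
      - M 0 1 * (M 1 0 * (M 2 2 * M 3 3 - M 2 3 * M 3 2) - M 1 2 * (M 2 0 * M 3 3 - M 2 3 * M 3 0)
        + M 1 3 * (M 2 0 * M 3 2 - M 2 2 * M 3 0))
      + M 0 2 * (M 1 0 * (M 2 1 * M 3 3 - M 2 3 * M 3 1) - M 1 1 * (M 2 0 * M 3 3 - M 2 3 * M 3 0)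
        + M 1 3 * (M 2 0 * M 3 1 - M 2 1 * M 3 0))
      - M 0 3 * (M 1 0 * (M 2 1 * M 3 2 - M 2 2 * M 3 1) - M 1 1 * (M 2 0 * M 3 2 - M 2 2 * M 3 0)
        + M 1 2 * (M 2 0 * M 3 1 - M 2 1 * M 3 0)) := by
  simp only [Matrix.det_succ_row_zero, Fin.sum_univ_succ]
  simp [Fin.succAbove]
  ring

/-- The maximal minor of `quadricCoeff a b` omitting two columns is, up to sign, `Q` times the
complementary Plücker coordinate of `pairProd a` and `pairProd b`. -/
theorem det_quadricCoeff_submatrix {K : Type*} [CommRing K] (a b : Fin 4 → K)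
    (l : Fin 6) (k : Fin 5) :
    ((quadricCoeff a b).submatrix id (l.succAbove ∘ k.succAbove)).det =
      (-1) ^ (l + k : ℕ) * quadricQ a b *
        (pairProd a l * pairProd b (l.succAbove k) -
          pairProd a (l.succAbove k) * pairProd b l) := by
  rw [det_fin_four]
  fin_cases l <;> fin_cases k <;>
    simp [quadricCoeff, quadricQ, pairProd, Fin.succAbove] <;> ring

theorem exists_eq_succAbove_comp_succAbove (f : Fin 4 ↪o Fin 6) :
    ∃ (l : Fin 6) (k : Fin 5), (f : Fin 4 → Fin 6) = l.succAbove ∘ k.succAbove := by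
  have key : ∀ x y z w : Fin 6, x < y → y < z → z < w →
      ∃ (l : Fin 6) (k : Fin 5), ![x, y, z, w] = l.succAbove ∘ k.succAbove := by
    decide
  have hf : (f : Fin 4 → Fin 6) = ![f 0, f 1, f 2, f 3] := by
    funext i
    fin_cases i <;> rfl
  rw [hf]
  exact key _ _ _ _ (f.strictMono (by decide)) (f.strictMono (by decide))
    (f.strictMono (by decide))

/-- `Q` is an alternating bilinear form in `pairProd a` and `pairProd b`, evaluated on vectors
of a special form; hence it vanishes if it annihilates their Plücker coordinates. -/
theorem quadricQ_eq_zero_of_pluecker {K : Type*} [Field K] (a b : Fin 4 → K)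
    (h : ∀ i j, i ≠ j →
      quadricQ a b * (pairProd a i * pairProd b j - pairProd a j * pairProd b i) = 0) :
    quadricQ a b = 0 := by
  by_contra hQ
  have hP (i j : Fin 6) : pairProd a i * pairProd b j = pairProd a j * pairProd b i := by
    rcases eq_or_ne i j with rfl | hij
    · rfl
    · exact sub_eq_zero.1 ((mul_eq_zero.1 (h i j hij)).resolve_left hQ)
  have hB (u v : Fin 4 → K) : quadricQ u v = -(pairProd u 4 * pairProd v 1) +
      pairProd u 2 * pairProd v 3 + pairProd u 3 * pairProd v 2 - pairProd u 0 * pairProd v 5 := by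
    simp [quadricQ, pairProd]
    ring
  have hbb : quadricQ b b = 0 := by
    rw [quadricQ]
    ring
  have hb (j : Fin 6) : pairProd b j = 0 := by
    refine (mul_eq_zero.1 ?_).resolve_left hQ
    have := hB b b
    rw [hbb] at this
    rw [hB]
    linear_combination -pairProd b 1 * hP 4 j + pairProd b 3 * hP 2 j + pairProd b 2 * hP 3 j
      - pairProd b 5 * hP 0 j - pairProd a j * this
  exact hQ (by rw [hB]; simp [hb])

theorem linearIndependent_quadricCoeff_iff {K : Type*} [Field K] (a b : Fin 4 → K) :
    LinearIndependent K (quadricCoeff a b).row ↔ quadricQ a b ≠ 0 := by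
  rw [linearIndependent_iff_exists_minor_ne_zero]
  constructor
  · rintro ⟨f, hf⟩ hQ
    obtain ⟨l, k, hlk⟩ := exists_eq_succAbove_comp_succAbove f
    rw [hlk, det_quadricCoeff_submatrix, hQ] at hf
    simp at hf
  · contrapose!
    intro h
    refine quadricQ_eq_zero_of_pluecker a b fun i j hij => ?_
    obtain ⟨k, rfl⟩ := Fin.exists_succAbove_eq hij.symm
    have hdet : ((quadricCoeff a b).submatrix id (i.succAbove ∘ k.succAbove)).det = 0 :=
      h (k.succAboveOrderEmb.trans i.succAboveOrderEmb)
    rw [det_quadricCoeff_submatrix, mul_assoc] at hdet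
    exact (mul_eq_zero.1 hdet).resolve_left (pow_ne_zero _ (by simp))

/-- The four reducible quadrics of the set `𝒮` (with points 0,1,2,3 at the
standard basis) are linearly dependent iff `Q = 0`. -/
theorem basis_S_dependent_iff_Q_eq_zero {K : Type*} [Field K] [CharZero K]
    (v4 v5 : Fin 4 → K) :
    ¬ LinearIndependent K
        ![linForm (Pi.single 0 1) (Pi.single 1 1) v5 *
            linForm (Pi.single 2 1) (Pi.single 3 1) v4,
          linForm (Pi.single 0 1) (Pi.single 1 1) (Pi.single 2 1) *
            linForm (Pi.single 3 1) v4 v5,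
          linForm (Pi.single 0 1) (Pi.single 2 1) v4 *
            linForm (Pi.single 1 1) (Pi.single 3 1) v5,
          linForm (Pi.single 0 1) v4 v5 *
            linForm (Pi.single 1 1) (Pi.single 2 1) (Pi.single 3 1)] ↔
      -(v5 0 * v4 1 * v5 2 * v4 3) + v4 0 * v5 1 * v5 2 * v4 3
        + v5 0 * v4 1 * v4 2 * v5 3 - v4 0 * v4 1 * v5 2 * v5 3 = 0 := by
  rw [quadrics_eq_linearCombination,
    LinearMap.linearIndependent_iff _
      (LinearMap.ker_eq_bot.2 (linearIndependent_pairProd_X K).fintypeLinearCombination_injective),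
    linearIndependent_quadricCoeff_iff, not_not, quadricQ]
end
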